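/- arXiv:2003.10786 — 3 statements merged into one kernel-verified Lean document; each statement's English description precedes it below -/
import Mathlib

section
/- (General interpolation in Morrey spaces.) Let 1 ≤ p₁ < p₃ < p₂ < ∞, let 0 ≤ μ₁, μ₂, μ₃ < 3 and k ∈ (0,1) be such that 1/p₃ = k/p₁ + (1−k)/p₂ and μ₃/p₃ = (μ₁/p₁)k + (μ₂/p₂)(1−k). Then there exists a constant C > 0 such that for every f ∈ M^{p₁,μ₁}(ℝ³) ∩ M^{p₂,μ₂}(ℝ³), ‖f‖_{p₃,μ₃} ≤ C ‖f‖_{p₁,μ₁}^{k} ‖f‖_{p₂,μ₂}^{1−k}. -/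
open MeasureTheory Metric Real Set Filter
open scoped ENNReal NNReal BigOperators Topology

noncomputable section

abbrev E3 : Type := EuclideanSpace ℝ (Fin 3)

/-- Morrey norm `‖f‖_{M^{p,λ}(ℝ³)}`. -/
def morreyNorm {F : Type*} [NormedAddCommGroup F] (p lam : ℝ) (f : E3 → F) : ℝ≥0∞ :=
  ⨆ (x : E3) (r : ℝ) (_ : 0 < r),
    ENNReal.ofReal (r ^ (-(lam / p))) *
      (∫⁻ y in Metric.ball x r, (‖f y‖₊ : ℝ≥0∞) ^ p) ^ (1 / p)

/-- Interpolation of (lower) Lebesgue integrals of powers; no measurability is required. -/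
theorem lintegral_rpow_interpolation {α : Type*} [MeasurableSpace α] (ν : Measure α)
    {p q s k : ℝ} (hp₀ : 0 < p) (hq₀ : 0 < q) (hs₀ : 0 < s) (hk : 0 < k) (hk' : k < 1)
    (hs : 1 / s = k / p + (1 - k) / q) (g : α → ℝ≥0∞) :
    (∫⁻ y, g y ^ s ∂ν) ^ (1 / s) ≤
      ((∫⁻ y, g y ^ p ∂ν) ^ (1 / p)) ^ k * ((∫⁻ y, g y ^ q ∂ν) ^ (1 / q)) ^ (1 - k) := by
  obtain ⟨φ, hφ, hφ_le, hφ_eq⟩ := exists_measurable_le_lintegral_eq ν (fun y => g y ^ s)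
  have hroot : ∀ y, φ y ^ (1 / s) ≤ g y := fun y => by
    rw [one_div]
    exact (ENNReal.rpow_inv_le_iff hs₀).2 (hφ_le y)
  have hsum : k * s / p + (1 - k) * s / q = 1 := by
    calc
      _ = (k / p + (1 - k) / q) * s := by ring
      _ = 1 := by rw [← hs, one_div_mul_cancel hs₀.ne']
  have h1k : 0 < 1 - k := sub_pos.2 hk'
  have hsplit : ∀ y, φ y =
      ((φ y ^ (1 / s)) ^ p) ^ (k * s / p) * ((φ y ^ (1 / s)) ^ q) ^ ((1 - k) * s / q) := by
    intro y
    simp only [← ENNReal.rpow_mul]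
    rw [← ENNReal.rpow_add_of_nonneg _ _ (by positivity) (by positivity)]
    have : 1 / s * p * (k * s / p) + 1 / s * q * ((1 - k) * s / q) = 1 := by
      field_simp
      ring
    rw [this, ENNReal.rpow_one]
  have hholder : ∫⁻ y, g y ^ s ∂ν ≤
      (∫⁻ y, g y ^ p ∂ν) ^ (k * s / p) * (∫⁻ y, g y ^ q ∂ν) ^ ((1 - k) * s / q) := by
    rw [hφ_eq, lintegral_congr hsplit]
    refine (ENNReal.lintegral_mul_norm_pow_le (by fun_prop) (by fun_prop)
      (by positivity) (by positivity) hsum).trans ?_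
    gcongr with y y
    · exact hroot y
    · exact hroot y
  refine (ENNReal.rpow_le_rpow hholder (by positivity : 0 ≤ 1 / s)).trans_eq ?_
  rw [ENNReal.mul_rpow_of_nonneg _ _ (by positivity)]
  simp only [← ENNReal.rpow_mul]
  congr 2 <;> field_simp

theorem le_morreyNorm {F : Type*} [NormedAddCommGroup F] (p lam : ℝ) (f : E3 → F) (x : E3)
    {r : ℝ} (hr : 0 < r) :
    ENNReal.ofReal (r ^ (-(lam / p))) *
      (∫⁻ y in Metric.ball x r, (‖f y‖₊ : ℝ≥0∞) ^ p) ^ (1 / p) ≤ morreyNorm p lam f :=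
  le_iSup_of_le x (le_iSup_of_le r (le_iSup_of_le hr le_rfl))

/-- **General interpolation in Morrey spaces.**  If `1 ≤ p₁ < p₃ < p₂`,
`1/p₃ = k/p₁ + (1-k)/p₂` and `μ₃/p₃ = (μ₁/p₁)k + (μ₂/p₂)(1-k)` with `k ∈ (0,1)` and
`μ₁, μ₂, μ₃ ∈ [0,3)`, then `‖f‖_{p₃,μ₃} ≤ C ‖f‖_{p₁,μ₁}^k ‖f‖_{p₂,μ₂}^{1-k}`. -/
theorem morrey_general_interpolation (p₁ p₂ p₃ μ₁ μ₂ μ₃ k : ℝ)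
    (hp₁ : 1 ≤ p₁) (h₁₃ : p₁ < p₃) (h₃₂ : p₃ < p₂)
    (hμ₁ : 0 ≤ μ₁) (hμ₁' : μ₁ < 3) (hμ₂ : 0 ≤ μ₂) (hμ₂' : μ₂ < 3)
    (hμ₃ : 0 ≤ μ₃) (hμ₃' : μ₃ < 3) (hk : 0 < k) (hk' : k < 1)
    (hp : 1 / p₃ = k / p₁ + (1 - k) / p₂)
    (hμ : μ₃ / p₃ = (μ₁ / p₁) * k + (μ₂ / p₂) * (1 - k)) :
    ∃ C : ℝ, 0 < C ∧ ∀ f : E3 → ℝ,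
      morreyNorm p₃ μ₃ f ≤
        ENNReal.ofReal C * (morreyNorm p₁ μ₁ f ^ k * morreyNorm p₂ μ₂ f ^ (1 - k)) := by
  refine ⟨1, one_pos, fun f => ?_⟩
  have hp₁₀ : 0 < p₁ := one_pos.trans_le hp₁
  have hp₃₀ : 0 < p₃ := hp₁₀.trans h₁₃
  have hp₂₀ : 0 < p₂ := hp₃₀.trans h₃₂
  have h1k : 0 < 1 - k := sub_pos.2 hk'
  rw [ENNReal.ofReal_one, one_mul]
  refine iSup_le fun x => iSup_le fun r => iSup_le fun hr => ?_
  have hweight : ENNReal.ofReal (r ^ (-(μ₃ / p₃))) =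
      ENNReal.ofReal (r ^ (-(μ₁ / p₁))) ^ k * ENNReal.ofReal (r ^ (-(μ₂ / p₂))) ^ (1 - k) := by
    rw [ENNReal.ofReal_rpow_of_pos (by positivity), ENNReal.ofReal_rpow_of_pos (by positivity),
      ← ENNReal.ofReal_mul (by positivity), ← Real.rpow_mul hr.le, ← Real.rpow_mul hr.le,
      ← Real.rpow_add hr, hμ]
    congr 2
    ring
  calc
    _ ≤ _ := mul_le_mul_right (lintegral_rpow_interpolation _ hp₁₀ hp₂₀ hp₃₀ hk hk' hp _) _
    _ = _ := by
      rw [hweight, mul_mul_mul_comm, ← ENNReal.mul_rpow_of_nonneg _ _ hk.le,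
        ← ENNReal.mul_rpow_of_nonneg _ _ h1k.le]
    _ ≤ _ := mul_le_mul' (ENNReal.rpow_le_rpow (le_morreyNorm p₁ μ₁ f x hr) hk.le)
      (ENNReal.rpow_le_rpow (le_morreyNorm p₂ μ₂ f x hr) h1k.le)
end
end

section
/- (Riesz potential on Morrey spaces.) Let S(x) = |x|^{δ−3} for some δ ∈ (0,3). Let 1 < p < q < ∞ and 0 ≤ θ < 3 satisfy 1/p − 1/q = δ/(3−θ). Then there exists a positive constant C, independent of f, such that for all f ∈ M^{p,θ}(ℝ³), ‖S∗f‖_{q,θ} ≤ C ‖f‖_{p,θ}. -/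
open MeasureTheory Metric Real Set Filter
open scoped ENNReal NNReal BigOperators Topology

noncomputable section

theorem volume_ball_E3 (c : E3) {r : ℝ} (hr : 0 ≤ r) :
    volume (ball c r) = ENNReal.ofReal (r ^ 3) * volume (ball (0 : E3) 1) := by
  simpa using Measure.addHaar_ball (volume : Measure E3) c hr

/-- The uncentred Hardy–Littlewood maximal function. -/
def maximalFn (g : E3 → ℝ≥0∞) (x : E3) : ℝ≥0∞ :=
  ⨆ (c : E3) (r : ℝ) (_ : 0 < r),
    (ball c r).indicator (fun _ => (volume (ball c r))⁻¹ * ∫⁻ y in ball c r, g y) x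

theorem measurable_maximalFn (g : E3 → ℝ≥0∞) : Measurable (maximalFn g) := by
  apply LowerSemicontinuous.measurable
  unfold maximalFn
  exact lowerSemicontinuous_iSup fun c => lowerSemicontinuous_iSup fun r =>
    lowerSemicontinuous_iSup fun _ => isOpen_ball.lowerSemicontinuous_indicator zero_le

theorem maximalFn_le_iff {g : E3 → ℝ≥0∞} {x : E3} {a : ℝ≥0∞} :
    maximalFn g x ≤ a ↔ ∀ (c : E3) (r : ℝ), x ∈ ball c r →
      ∫⁻ y in ball c r, g y ≤ volume (ball c r) * a := by
  simp only [maximalFn, iSup_le_iff]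
  refine forall₂_congr fun c r => ⟨fun h hx => ?_, fun h hr => ?_⟩
  · have hr : 0 < r := pos_of_mem_ball hx
    have := h hr
    rw [indicator_of_mem hx] at this
    rwa [ENNReal.inv_mul_le_iff (measure_ball_pos _ _ hr).ne' measure_ball_lt_top.ne] at this
  · by_cases hx : x ∈ ball c r
    · rw [indicator_of_mem hx,
        ENNReal.inv_mul_le_iff (measure_ball_pos _ _ hr).ne' measure_ball_lt_top.ne]
      exact h hx
    · simp [indicator_of_notMem hx]

theorem setLIntegral_ball_le_maximalFn (g : E3 → ℝ≥0∞) {x c : E3} {r : ℝ} (hx : x ∈ ball c r) :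
    ∫⁻ y in ball c r, g y ≤ volume (ball c r) * maximalFn g x :=
  maximalFn_le_iff.1 le_rfl c r hx

theorem maximalFn_le_add_const {g h : E3 → ℝ≥0∞} {s : ℝ≥0∞} (hgh : ∀ y, g y ≤ h y + s) (x : E3) :
    maximalFn g x ≤ maximalFn h x + s := by
  refine maximalFn_le_iff.2 fun c r hx => ?_
  calc ∫⁻ y in ball c r, g y ≤ ∫⁻ y in ball c r, (h y + s) := lintegral_mono hgh
    _ = (∫⁻ y in ball c r, h y) + s * volume (ball c r) := by
        rw [lintegral_add_right _ measurable_const, setLIntegral_const]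
    _ ≤ volume (ball c r) * maximalFn h x + s * volume (ball c r) := by
        gcongr; exact setLIntegral_ball_le_maximalFn h hx
    _ = _ := by ring

/-- The weak type `(1,1)` inequality. -/
theorem mul_volume_lt_maximalFn_le (g : E3 → ℝ≥0∞) (t : ℝ≥0∞) :
    t * volume {x | t < maximalFn g x} ≤ 125 * ∫⁻ y, g y := by
  rcases eq_or_ne t 0 with rfl | ht0
  · simp
  rcases eq_or_ne t ⊤ with rfl | ht
  · simp
  by_cases hI : ∫⁻ y, g y = ⊤
  · simp [hI, ENNReal.mul_top]
  set V := volume (ball (0 : E3) 1) with hV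
  have hV0 : V ≠ 0 := (measure_ball_pos _ _ one_pos).ne'
  have hVt : V ≠ ⊤ := measure_ball_lt_top.ne
  set T : Set (E3 × ℝ) :=
    {a | 0 < a.2 ∧ t * volume (ball a.1 a.2) < ∫⁻ y in ball a.1 a.2, g y} with hT
  have hsub : {x | t < maximalFn g x} ⊆ ⋃ a ∈ T, ball a.1 a.2 := by
    intro x hx
    have hx' : ¬ maximalFn g x ≤ t := not_le.2 hx
    rw [maximalFn_le_iff] at hx'
    push Not at hx'
    obtain ⟨c, r, hxc, hlt⟩ := hx'
    rw [mul_comm] at hlt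
    exact mem_biUnion (x := (c, r)) ⟨pos_of_mem_ball hxc, hlt⟩ hxc
  set Q : ℝ≥0∞ := (∫⁻ y, g y) / (t * V) with hQ
  have htV : t * V ≠ 0 := mul_ne_zero ht0 hV0
  have hQt : Q ≠ ⊤ := ENNReal.div_ne_top hI htV
  have hbd : ∀ a ∈ T, a.2 ≤ 1 + Q.toReal := by
    rintro ⟨c, r⟩ ⟨hr, h⟩
    simp only at hr h ⊢
    rw [volume_ball_E3 c hr.le] at h
    have h1 : ENNReal.ofReal (r ^ 3) ≤ Q := by
      rw [hQ, ENNReal.le_div_iff_mul_le (Or.inl htV) (Or.inl (ENNReal.mul_ne_top ht hVt))]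
      calc _ = t * (ENNReal.ofReal (r ^ 3) * V) := by ring
        _ ≤ _ := h.le.trans (setLIntegral_le_lintegral _ _)
    have h2 : r ^ 3 ≤ Q.toReal := (ENNReal.ofReal_le_iff_le_toReal hQt).1 h1
    nlinarith [mul_nonneg hr.le (sq_nonneg (r - 1)), sq_nonneg (r - 1)]
  obtain ⟨u, huT, hdisj, hcov⟩ := Vitali.exists_disjoint_subfamily_covering_enlargement_closedBall
    T (fun a => a.1) (fun a => a.2) _ hbd 5 (by norm_num)
  have hcount : u.Countable := hdisj.countable_of_nonempty_interior fun a ha =>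
    ⟨a.1, ball_subset_interior_closedBall (mem_ball_self (huT ha).1)⟩
  have hsub' : {x | t < maximalFn g x} ⊆ ⋃ a ∈ u, closedBall a.1 (5 * a.2) := by
    refine hsub.trans (iUnion₂_subset fun a ha => ?_)
    obtain ⟨b, hb, hab⟩ := hcov a ha
    exact (ball_subset_closedBall.trans hab).trans
      (subset_biUnion_of_mem (u := fun a : E3 × ℝ => closedBall a.1 (5 * a.2)) hb)
  calc t * volume {x | t < maximalFn g x}
      ≤ t * ∑' a : u, volume (closedBall a.1.1 (5 * a.1.2)) := by
        gcongr
        exact (measure_mono hsub').trans (measure_biUnion_le _ hcount _)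
    _ = ∑' a : u, 125 * (t * volume (ball a.1.1 a.1.2)) := by
        rw [← ENNReal.tsum_mul_left]
        refine tsum_congr fun a => ?_
        have hr := (huT a.2).1
        rw [volume_ball_E3 _ hr.le, Measure.addHaar_closedBall _ _ (by positivity),
          finrank_euclideanSpace_fin, mul_pow, ENNReal.ofReal_mul (by positivity)]
        norm_num
        ring
    _ ≤ ∑' a : u, 125 * ∫⁻ y in closedBall a.1.1 a.1.2, g y := by
        refine ENNReal.tsum_le_tsum fun a => ?_
        gcongr
        exact (huT a.2).2.le.trans (lintegral_mono_set ball_subset_closedBall)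
    _ = 125 * ∫⁻ y in ⋃ a ∈ u, closedBall a.1 a.2, g y := by
        rw [ENNReal.tsum_mul_left,
          lintegral_biUnion hcount (fun _ _ => measurableSet_closedBall) hdisj]
    _ ≤ _ := by
        gcongr
        exact Measure.restrict_le_self

theorem setLIntegral_Ioc_rpow {s R : ℝ} (hs : 0 < s) (hR : 0 ≤ R) :
    ∫⁻ t in Ioc 0 R, ENNReal.ofReal (t ^ (s - 1)) = ENNReal.ofReal (R ^ s / s) := by
  have hi : IntegrableOn (fun t : ℝ => t ^ (s - 1)) (Ioc 0 R) :=
    (intervalIntegrable_iff_integrableOn_Ioc_of_le hR).1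
      (intervalIntegral.intervalIntegrable_rpow' (by linarith))
  rw [← ofReal_integral_eq_lintegral_ofReal hi
    ((ae_restrict_mem measurableSet_Ioc).mono fun t ht => rpow_nonneg ht.1.le _),
    ← intervalIntegral.integral_of_le hR, integral_rpow (Or.inl (by linarith))]
  simp [hs.ne']

theorem setLIntegral_Ioi_rpow_neg {s R : ℝ} (hs : 0 < s) (hR : 0 < R) :
    ∫⁻ t in Ioi R, ENNReal.ofReal (t ^ (-s - 1)) = ENNReal.ofReal (R ^ (-s) / s) := by
  rw [← ofReal_integral_eq_lintegral_ofReal (integrableOn_Ioi_rpow_of_lt (by linarith) hR)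
    ((ae_restrict_mem measurableSet_Ioi).mono fun t ht => rpow_nonneg (hR.trans ht).le _),
    integral_Ioi_rpow_of_lt (by linarith) hR]
  congr 1
  simp [neg_div_neg_eq]

theorem lintegral_layercake_rpow {s : ℝ} (hs : 0 < s) (a : ℝ≥0∞) :
    ∫⁻ t in Ioi (0 : ℝ), {t : ℝ | ENNReal.ofReal t < a}.indicator
      (fun t => ENNReal.ofReal (t ^ (s - 1))) t = a ^ s / ENNReal.ofReal s := by
  have hms : ∀ b : ℝ≥0∞, MeasurableSet {t : ℝ | ENNReal.ofReal t < b} := fun b =>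
    measurableSet_lt ENNReal.measurable_ofReal measurable_const
  have hfin : ∀ b : ℝ, 0 ≤ b →
      ∫⁻ t in Ioi (0 : ℝ), {t : ℝ | ENNReal.ofReal t < ENNReal.ofReal b}.indicator
        (fun t => ENNReal.ofReal (t ^ (s - 1))) t = ENNReal.ofReal b ^ s / ENNReal.ofReal s := by
    intro b hb
    rw [lintegral_indicator (hms _), Measure.restrict_restrict (hms _),
      ENNReal.ofReal_rpow_of_nonneg hb hs.le, ← ENNReal.ofReal_div_of_pos hs,
      ← setLIntegral_Ioc_rpow hs hb, ← restrict_Ioo_eq_restrict_Ioc]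
    congr 2
    ext t
    simp only [mem_inter_iff, mem_ofPred_eq, mem_Ioi, mem_Ioo]
    constructor
    · rintro ⟨h1, h2⟩
      exact ⟨h2, (ENNReal.ofReal_lt_ofReal_iff_of_nonneg h2.le).1 h1⟩
    · rintro ⟨h1, h2⟩
      exact ⟨(ENNReal.ofReal_lt_ofReal_iff_of_nonneg h1.le).2 h2, h1⟩
  by_cases ha : a = ⊤
  · subst ha
    rw [ENNReal.top_rpow_of_pos hs, ENNReal.top_div_of_ne_top ENNReal.ofReal_ne_top]
    have hle : ∀ n : ℕ, (n : ℝ≥0∞) ^ s / ENNReal.ofReal s ≤ ∫⁻ t in Ioi (0 : ℝ),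
        {t : ℝ | ENNReal.ofReal t < ⊤}.indicator (fun t => ENNReal.ofReal (t ^ (s - 1))) t := by
      intro n
      rw [← ENNReal.ofReal_natCast, ← hfin n n.cast_nonneg]
      refine lintegral_mono fun t => indicator_le_indicator_of_subset ?_ (fun _ => zero_le) t
      exact fun t _ => ENNReal.ofReal_lt_top
    have h1 : Tendsto (fun n : ℕ => (n : ℝ≥0∞) ^ s) atTop (𝓝 (⊤ ^ s)) :=
      (ENNReal.continuous_rpow_const.tendsto _).comp ENNReal.tendsto_nat_nhds_top
    have h2 := ENNReal.Tendsto.div_const h1 (b := ENNReal.ofReal s) (Or.inl (by simp [hs]))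
    rw [ENNReal.top_rpow_of_pos hs, ENNReal.top_div_of_ne_top ENNReal.ofReal_ne_top] at h2
    exact top_unique (le_of_tendsto' h2 hle)
  · rw [← ENNReal.ofReal_toReal ha]
    exact hfin _ ENNReal.toReal_nonneg

theorem lintegral_rpow_eq_layercake (μ : Measure E3) [SFinite μ] {s : ℝ} (hs : 0 < s)
    {G : E3 → ℝ≥0∞} (hG : Measurable G) :
    ∫⁻ x, G x ^ s ∂μ = ENNReal.ofReal s *
      ∫⁻ t in Ioi (0 : ℝ), ENNReal.ofReal (t ^ (s - 1)) * μ {x | ENNReal.ofReal t < G x} := by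
  have hs0 : ENNReal.ofReal s ≠ 0 := by simpa using hs
  have hpow : ∀ x, G x ^ s = ENNReal.ofReal s * ∫⁻ t in Ioi (0 : ℝ),
      {t : ℝ | ENNReal.ofReal t < G x}.indicator (fun t => ENNReal.ofReal (t ^ (s - 1))) t := by
    intro x
    rw [lintegral_layercake_rpow hs, ENNReal.mul_div_cancel hs0 ENNReal.ofReal_ne_top]
  have hset : MeasurableSet {z : E3 × ℝ | ENNReal.ofReal z.2 < G z.1} :=
    measurableSet_lt (ENNReal.measurable_ofReal.comp measurable_snd) (hG.comp measurable_fst)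
  have hmeas : Measurable (Function.uncurry fun (x : E3) (t : ℝ) =>
      {t : ℝ | ENNReal.ofReal t < G x}.indicator (fun t => ENNReal.ofReal (t ^ (s - 1))) t) :=
    Measurable.indicator (f := fun z : E3 × ℝ => ENNReal.ofReal (z.2 ^ (s - 1)))
      (by fun_prop) hset
  simp_rw [hpow]
  rw [lintegral_const_mul' _ _ ENNReal.ofReal_ne_top, lintegral_lintegral_swap hmeas.aemeasurable]
  congr 1
  refine lintegral_congr fun t => ?_
  rw [← setLIntegral_const, ← lintegral_indicator (measurableSet_lt measurable_const hG)]
  rfl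

/-- The strong type `(p,p)` inequality for the maximal function. -/
theorem exists_lintegral_maximalFn_rpow_le {p : ℝ} (hp : 1 < p) :
    ∃ C : ℝ≥0∞, C ≠ ⊤ ∧ ∀ g : E3 → ℝ≥0∞, Measurable g →
      ∫⁻ x, maximalFn g x ^ p ≤ C * ∫⁻ x, g x ^ p := by
  have hp1 : 0 < p - 1 := by linarith
  have hp0 : ENNReal.ofReal (p - 1) ≠ 0 := by simpa using hp1
  refine ⟨ENNReal.ofReal p * (250 * ((ENNReal.ofReal (p - 1))⁻¹ * 2 ^ (p - 1))), ?_, ?_⟩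
  · have : (2 : ℝ≥0∞) ^ (p - 1) ≠ ⊤ := ENNReal.rpow_ne_top_of_nonneg hp1.le (by simp)
    finiteness
  intro g hg
  set ν := (volume : Measure E3).withDensity g with hν
  have hpt : ∀ t ∈ Ioi (0 : ℝ), ENNReal.ofReal (t ^ (p - 1)) *
      volume {x | ENNReal.ofReal t < maximalFn g x} ≤
      250 * (ENNReal.ofReal (t ^ (p - 1 - 1)) * ν {x | ENNReal.ofReal t < 2 * g x}) := by
    intro t ht
    have ht : 0 < t := ht
    have htt : ENNReal.ofReal t = 2 * ENNReal.ofReal (t / 2) := by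
      rw [← ENNReal.ofReal_ofNat, ← ENNReal.ofReal_mul (by norm_num)]
      congr 1; ring
    set w := ENNReal.ofReal (t / 2) with hw
    set A : Set E3 := {y | w < g y} with hA
    have hAm : MeasurableSet A := measurableSet_lt measurable_const hg
    have hνA : ν {x | ENNReal.ofReal t < 2 * g x} = ∫⁻ y, A.indicator g y := by
      rw [lintegral_indicator hAm, hν, ← withDensity_apply _ hAm, htt]
      congr 1
      ext y
      simp only [hA, mem_ofPred_eq]
      exact ENNReal.mul_lt_mul_iff_right (by simp) (by simp)
    have hsub : {x | ENNReal.ofReal t < maximalFn g x} ⊆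
        {x | w < maximalFn (A.indicator g) x} := by
      intro x hx
      have h1 : maximalFn g x ≤ maximalFn (A.indicator g) x + w := by
        refine maximalFn_le_add_const (fun y => ?_) x
        by_cases hy : y ∈ A
        · simp [indicator_of_mem hy]
        · simpa [indicator_of_notMem hy] using not_lt.1 hy
      have h2 : w + w < maximalFn (A.indicator g) x + w := by
        rw [← two_mul, ← htt]
        exact lt_of_lt_of_le hx h1
      exact lt_of_add_lt_add_right h2
    have hweak := mul_volume_lt_maximalFn_le (A.indicator g) w
    have hsplit : ENNReal.ofReal (t ^ (p - 1)) = ENNReal.ofReal (t ^ (p - 1 - 1)) * (2 * w) := by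
      rw [← htt, ← ENNReal.ofReal_mul (by positivity), ← rpow_add_one ht.ne']
      congr 2; ring
    calc _ ≤ ENNReal.ofReal (t ^ (p - 1 - 1)) * (2 * w) *
          volume {x | w < maximalFn (A.indicator g) x} := by
          rw [hsplit]; gcongr
      _ = ENNReal.ofReal (t ^ (p - 1 - 1)) *
          (2 * (w * volume {x | w < maximalFn (A.indicator g) x})) := by ring
      _ ≤ ENNReal.ofReal (t ^ (p - 1 - 1)) * (2 * (125 * ∫⁻ y, A.indicator g y)) := by gcongr
      _ = _ := by rw [hνA]; ring
  have hlayer := lintegral_rpow_eq_layercake ν hp1 (hg.const_mul 2)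
  rw [lintegral_withDensity_eq_lintegral_mul _ hg (by fun_prop)] at hlayer
  have hI : ∫⁻ t in Ioi (0 : ℝ), ENNReal.ofReal (t ^ (p - 1 - 1)) *
      ν {x | ENNReal.ofReal t < 2 * g x} =
      (ENNReal.ofReal (p - 1))⁻¹ * (2 ^ (p - 1) * ∫⁻ x, g x ^ p) := by
    have h3 : ∫⁻ x, (g * fun x => (2 * g x) ^ (p - 1)) x = 2 ^ (p - 1) * ∫⁻ x, g x ^ p := by
      rw [← lintegral_const_mul _ (by fun_prop)]
      refine lintegral_congr fun x => ?_
      have h4 : g x ^ p = g x * g x ^ (p - 1) := by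
        conv_rhs => rw [← ENNReal.rpow_one (g x), ← ENNReal.rpow_mul,
          ← ENNReal.rpow_add_of_nonneg _ _ zero_le_one (by linarith)]
        congr 1; ring
      rw [Pi.mul_apply, h4, ENNReal.mul_rpow_of_nonneg _ _ hp1.le]
      ring
    rw [← h3, hlayer, ← mul_assoc, ENNReal.inv_mul_cancel hp0 ENNReal.ofReal_ne_top, one_mul]
  rw [lintegral_rpow_eq_layercake _ (by linarith) (measurable_maximalFn g)]
  calc _ ≤ ENNReal.ofReal p * ∫⁻ t in Ioi (0 : ℝ), 250 * (ENNReal.ofReal (t ^ (p - 1 - 1)) *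
        ν {x | ENNReal.ofReal t < 2 * g x}) := by
        refine mul_le_mul_right ?_ _
        exact setLIntegral_mono' measurableSet_Ioi hpt
    _ = _ := by
        rw [lintegral_const_mul' _ _ (by simp), hI]
        ring

/-- `g` satisfies the Morrey growth bound of exponents `p`, `θ` with constant `N`. -/
def MorreyBound (p θ : ℝ) (g : E3 → ℝ≥0∞) (N : ℝ≥0∞) : Prop :=
  ∀ (x : E3) (r : ℝ), 0 < r → ∫⁻ y in ball x r, g y ^ p ≤ ENNReal.ofReal (r ^ θ) * N ^ p

theorem MorreyBound.setLIntegral_ball_le {p θ : ℝ} (hp : 1 < p) {g : E3 → ℝ≥0∞}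
    (hg : Measurable g) {N : ℝ≥0∞} (hN : MorreyBound p θ g N) (c : E3) {r : ℝ} (hr : 0 < r) :
    ∫⁻ y in ball c r, g y ≤ volume (ball c r) *
      (volume (ball (0 : E3) 1) ^ (-(1 / p)) * ENNReal.ofReal (r ^ (-((3 - θ) / p))) * N) := by
  have hp0 : 0 < p := by linarith
  have hconj := Real.HolderConjugate.conjExponent hp
  set V := volume (ball (0 : E3) 1) with hV
  have hV0 : V ≠ 0 := (measure_ball_pos _ _ one_pos).ne'
  have hVt : V ≠ ⊤ := measure_ball_lt_top.ne
  have hB0 : volume (ball c r) ≠ 0 := (measure_ball_pos _ _ hr).ne'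
  have hBt : volume (ball c r) ≠ ⊤ := measure_ball_lt_top.ne
  have hold := ENNReal.lintegral_mul_le_Lp_mul_Lq (volume.restrict (ball c r)) hconj
    hg.aemeasurable (measurable_const (a := (1 : ℝ≥0∞))).aemeasurable
  have hexp : 1 / p.conjExponent = 1 + -(1 / p) := by
    have := hconj.inv_add_inv_eq_one
    rw [one_div, one_div]; linarith
  simp only [Pi.mul_apply, mul_one, ENNReal.one_rpow, lintegral_one, Measure.restrict_apply_univ,
    hexp] at hold
  refine hold.trans ?_
  rw [ENNReal.rpow_add _ _ hB0 hBt, ENNReal.rpow_one]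
  have h1 : (∫⁻ y in ball c r, g y ^ p) ^ (1 / p) ≤ ENNReal.ofReal (r ^ (θ / p)) * N := by
    calc _ ≤ (ENNReal.ofReal (r ^ θ) * N ^ p) ^ (1 / p) := by gcongr; exact hN c r hr
      _ = _ := by
        rw [ENNReal.mul_rpow_of_nonneg _ _ (by positivity), ← ENNReal.rpow_mul,
          mul_one_div_cancel hp0.ne', ENNReal.rpow_one,
          ENNReal.ofReal_rpow_of_pos (by positivity), ← rpow_mul hr.le, mul_one_div]
  have h2 : volume (ball c r) ^ (-(1 / p)) = ENNReal.ofReal (r ^ (-(3 / p))) * V ^ (-(1 / p)) := by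
    rw [volume_ball_E3 c hr.le, ENNReal.mul_rpow_of_ne_zero (by simpa using pow_pos hr 3) hV0,
      ENNReal.ofReal_rpow_of_pos (by positivity), ← rpow_natCast, ← rpow_mul hr.le]
    congr 3
    push_cast; ring
  have h3 : ENNReal.ofReal (r ^ (θ / p)) * ENNReal.ofReal (r ^ (-(3 / p))) =
      ENNReal.ofReal (r ^ (-((3 - θ) / p))) := by
    rw [← ENNReal.ofReal_mul (by positivity), ← rpow_add hr]
    congr 2; ring
  calc _ ≤ ENNReal.ofReal (r ^ (θ / p)) * N * (volume (ball c r) *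
        (ENNReal.ofReal (r ^ (-(3 / p))) * V ^ (-(1 / p)))) := by rw [h2]; gcongr
    _ = _ := by rw [← h3]; ring

/-- The maximal function is bounded on Morrey spaces. -/
theorem exists_morreyBound_maximalFn {p θ : ℝ} (hp : 1 < p) (hθ : θ < 3) :
    ∃ C : ℝ≥0∞, C ≠ ⊤ ∧ ∀ (g : E3 → ℝ≥0∞) (N : ℝ≥0∞), Measurable g → MorreyBound p θ g N →
      MorreyBound p θ (maximalFn g) (C * N) := by
  have hp0 : 0 < p := by linarith
  obtain ⟨C₁, hC₁, hmax⟩ := exists_lintegral_maximalFn_rpow_le hp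
  set V := volume (ball (0 : E3) 1) with hV
  have hV0 : V ≠ 0 := (measure_ball_pos _ _ one_pos).ne'
  have hVt : V ≠ ⊤ := measure_ball_lt_top.ne
  set D : ℝ≥0∞ := C₁ * ENNReal.ofReal (3 ^ θ) + V * (V ^ (-(1 / p))) ^ p with hD
  have hVp : V ^ (-(1 / p)) ≠ ⊤ := by
    simp [ENNReal.rpow_eq_top_iff, hV0, hVt]
  have hDt : D ≠ ⊤ := by
    have : (V ^ (-(1 / p))) ^ p ≠ ⊤ := ENNReal.rpow_ne_top_of_nonneg hp0.le hVp
    finiteness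
  refine ⟨D ^ (1 / p), ENNReal.rpow_ne_top_of_nonneg (by positivity) hDt, ?_⟩
  intro g N hg hN x₀ r hr
  set g₁ := (ball x₀ (3 * r)).indicator g with hg₁
  set L : ℝ≥0∞ := V ^ (-(1 / p)) * ENNReal.ofReal (r ^ (-((3 - θ) / p))) * N with hL
  have hpt : ∀ x ∈ ball x₀ r, maximalFn g x ^ p ≤ maximalFn g₁ x ^ p + L ^ p := by
    intro x hx
    have hle : maximalFn g x ≤ max (maximalFn g₁ x) L := by
      refine maximalFn_le_iff.2 fun c s hxs => ?_
      rcases lt_or_ge s r with hsr | hrs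
      · have hsub : ball c s ⊆ ball x₀ (3 * r) := by
          refine ball_subset_ball' ?_
          have h1 : dist x c < s := hxs
          have h2 : dist x x₀ < r := hx
          linarith [dist_triangle_left c x₀ x]
        calc ∫⁻ y in ball c s, g y = ∫⁻ y in ball c s, g₁ y :=
              setLIntegral_congr_fun measurableSet_ball fun y hy => by
                simp [hg₁, indicator_of_mem (hsub hy)]
          _ ≤ volume (ball c s) * maximalFn g₁ x := setLIntegral_ball_le_maximalFn _ hxs
          _ ≤ _ := by gcongr; exact le_max_left _ _
      · refine (hN.setLIntegral_ball_le hp hg c (hr.trans_le hrs)).trans ?_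
        gcongr
        refine le_trans ?_ (le_max_right _ _)
        refine mul_le_mul_left (mul_le_mul_right (ENNReal.ofReal_le_ofReal ?_) _) _
        refine rpow_le_rpow_of_nonpos hr hrs ?_
        rw [neg_nonpos]
        exact div_nonneg (by linarith) hp0.le
    calc _ ≤ max (maximalFn g₁ x) L ^ p := by gcongr
      _ ≤ _ := by
        rcases max_choice (maximalFn g₁ x) L with h | h <;> rw [h]
        · exact le_self_add
        · exact le_add_self
  have h1 : ∫⁻ x, g₁ x ^ p ≤ ENNReal.ofReal ((3 * r) ^ θ) * N ^ p := by
    refine le_trans (le_of_eq ?_) (hN x₀ (3 * r) (by positivity))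
    rw [← lintegral_indicator measurableSet_ball]
    refine lintegral_congr fun x => ?_
    by_cases hx : x ∈ ball x₀ (3 * r)
    · simp only [hg₁, indicator_of_mem hx]
    · simp only [hg₁, indicator_of_notMem hx, ENNReal.zero_rpow_of_pos hp0]
  have h2 : L ^ p * volume (ball x₀ r) =
      V * (V ^ (-(1 / p))) ^ p * ENNReal.ofReal (r ^ θ) * N ^ p := by
    have h3 : ENNReal.ofReal (r ^ (-((3 - θ) / p))) ^ p * ENNReal.ofReal (r ^ 3) =
        ENNReal.ofReal (r ^ θ) := by
      rw [ENNReal.ofReal_rpow_of_pos (by positivity), ← ENNReal.ofReal_mul (by positivity),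
        ← rpow_mul hr.le, ← rpow_natCast, ← rpow_add hr]
      congr 2
      field_simp
      push_cast; ring
    rw [hL, ENNReal.mul_rpow_of_nonneg _ _ hp0.le, ENNReal.mul_rpow_of_nonneg _ _ hp0.le,
      volume_ball_E3 _ hr.le, ← h3]
    ring
  calc ∫⁻ x in ball x₀ r, maximalFn g x ^ p
      ≤ ∫⁻ x in ball x₀ r, (maximalFn g₁ x ^ p + L ^ p) :=
        setLIntegral_mono' measurableSet_ball hpt
    _ = (∫⁻ x in ball x₀ r, maximalFn g₁ x ^ p) + L ^ p * volume (ball x₀ r) := by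
        rw [lintegral_add_right _ measurable_const, setLIntegral_const]
    _ ≤ C₁ * (ENNReal.ofReal ((3 * r) ^ θ) * N ^ p) + L ^ p * volume (ball x₀ r) := by
        gcongr
        refine (setLIntegral_le_lintegral _ _).trans
          ((hmax g₁ (hg.indicator measurableSet_ball)).trans ?_)
        gcongr
    _ = ENNReal.ofReal (r ^ θ) * (D ^ (1 / p) * N) ^ p := by
        rw [h2, ENNReal.mul_rpow_of_nonneg _ _ hp0.le, ← ENNReal.rpow_mul D,
          one_div_mul_cancel hp0.ne', ENNReal.rpow_one, hD, mul_rpow (by norm_num) hr.le,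
          ENNReal.ofReal_mul (by positivity)]
        ring

theorem lintegral_riesz_le_layercake {δ : ℝ} (hδ : δ < 3) {g : E3 → ℝ≥0∞} (hg : Measurable g)
    (x : E3) :
    ∫⁻ y, ENNReal.ofReal (‖x - y‖ ^ (δ - 3)) * g y ≤ ENNReal.ofReal (3 - δ) *
      ∫⁻ ρ in Ioi (0 : ℝ), ENNReal.ofReal (ρ ^ (δ - 4)) * ∫⁻ y in ball x ρ, g y := by
  have hs : 0 < 3 - δ := by linarith
  have hker : ∀ y, ENNReal.ofReal (‖x - y‖ ^ (δ - 3)) ≤ ENNReal.ofReal (3 - δ) *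
      ∫⁻ ρ in Ioi (0 : ℝ), {ρ : ℝ | dist y x < ρ}.indicator
        (fun ρ => ENNReal.ofReal (ρ ^ (δ - 4))) ρ := by
    intro y
    rw [← dist_eq_norm, dist_comm]
    rcases (dist_nonneg (x := y) (y := x)).eq_or_lt with h0 | h0
    · rw [← h0, zero_rpow (by linarith)]
      simp
    · have hset : {ρ : ℝ | dist y x < ρ} = Ioi (dist y x) := rfl
      rw [hset, lintegral_indicator measurableSet_Ioi, Measure.restrict_restrict measurableSet_Ioi,
        inter_eq_left.2 (Ioi_subset_Ioi h0.le), show δ - 4 = -(3 - δ) - 1 by ring,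
        setLIntegral_Ioi_rpow_neg hs h0, ← ENNReal.ofReal_mul hs.le,
        mul_div_cancel₀ _ hs.ne', neg_sub]
  have hset : MeasurableSet {z : E3 × ℝ | dist z.1 x < z.2} :=
    measurableSet_lt (by fun_prop) measurable_snd
  have hmeas : Measurable (Function.uncurry fun (y : E3) (ρ : ℝ) =>
      {ρ : ℝ | dist y x < ρ}.indicator (fun ρ => ENNReal.ofReal (ρ ^ (δ - 4)) * g y) ρ) :=
    Measurable.indicator (f := fun z : E3 × ℝ => ENNReal.ofReal (z.2 ^ (δ - 4)) * g z.1)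
      (by fun_prop) hset
  calc _ ≤ ∫⁻ y, ENNReal.ofReal (3 - δ) * ∫⁻ ρ in Ioi (0 : ℝ), {ρ : ℝ | dist y x < ρ}.indicator
          (fun ρ => ENNReal.ofReal (ρ ^ (δ - 4)) * g y) ρ := by
        refine lintegral_mono fun y => ?_
        simp only [indicator_mul_left]
        have hind : Measurable ({ρ : ℝ | dist y x < ρ}.indicator
            fun ρ => ENNReal.ofReal (ρ ^ (δ - 4))) :=
          Measurable.indicator (by fun_prop) measurableSet_Ioi
        rw [lintegral_mul_const _ hind, ← mul_assoc]
        gcongr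
        exact hker y
    _ = _ := by
        rw [lintegral_const_mul' _ _ ENNReal.ofReal_ne_top,
          lintegral_lintegral_swap hmeas.aemeasurable]
        congr 1
        refine lintegral_congr fun ρ => ?_
        rw [← lintegral_const_mul _ hg, ← lintegral_indicator measurableSet_ball]
        rfl

theorem exists_lintegral_riesz_le_add {δ p θ b : ℝ} (hδ : 0 < δ) (hδ' : δ < 3) (hp : 1 < p)
    (hb : 0 < b) (hab : (3 - θ) / p = δ + b) :
    ∃ K : ℝ≥0∞, K ≠ ⊤ ∧ ∀ (g : E3 → ℝ≥0∞) (N : ℝ≥0∞), Measurable g → MorreyBound p θ g N →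
      ∀ (x : E3) (R : ℝ), 0 < R → ∫⁻ y, ENNReal.ofReal (‖x - y‖ ^ (δ - 3)) * g y ≤
        K * (ENNReal.ofReal (R ^ δ) * maximalFn g x + ENNReal.ofReal (R ^ (-b)) * N) := by
  set V := volume (ball (0 : E3) 1) with hV
  have hV0 : V ≠ 0 := (measure_ball_pos _ _ one_pos).ne'
  have hVt : V ≠ ⊤ := measure_ball_lt_top.ne
  have hVp : V ^ (-(1 / p)) ≠ ⊤ := by
    simp [ENNReal.rpow_eq_top_iff, hV0, hVt]
  set K₁ : ℝ≥0∞ := V * ENNReal.ofReal δ⁻¹ with hK₁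
  set K₂ : ℝ≥0∞ := V * V ^ (-(1 / p)) * ENNReal.ofReal b⁻¹ with hK₂
  refine ⟨ENNReal.ofReal (3 - δ) * (K₁ + K₂), by finiteness, ?_⟩
  intro g N hg hN x R hR
  refine (lintegral_riesz_le_layercake hδ' hg x).trans ?_
  rw [mul_assoc]
  gcongr
  set A := maximalFn g x with hA
  have hnear : ∫⁻ ρ in Ioc 0 R, ENNReal.ofReal (ρ ^ (δ - 4)) * ∫⁻ y in ball x ρ, g y ≤
      K₁ * (ENNReal.ofReal (R ^ δ) * A) := by
    calc _ ≤ ∫⁻ ρ in Ioc 0 R, ENNReal.ofReal (ρ ^ (δ - 1)) * (V * A) := by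
          refine setLIntegral_mono' measurableSet_Ioc fun ρ hρ => ?_
          have hρ0 : 0 < ρ := hρ.1
          have h1 : ENNReal.ofReal (ρ ^ (δ - 1)) =
              ENNReal.ofReal (ρ ^ (δ - 4)) * ENNReal.ofReal (ρ ^ 3) := by
            rw [← ENNReal.ofReal_mul (by positivity), ← rpow_natCast, ← rpow_add hρ0]
            congr 2; push_cast; ring
          rw [h1, mul_assoc, ← mul_assoc _ V, ← volume_ball_E3 x hρ0.le]
          gcongr
          exact setLIntegral_ball_le_maximalFn g (mem_ball_self hρ0)
      _ = ENNReal.ofReal (R ^ δ / δ) * (V * A) := by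
          rw [lintegral_mul_const _ (by fun_prop), setLIntegral_Ioc_rpow hδ hR.le]
      _ = _ := by
          rw [div_eq_mul_inv, ENNReal.ofReal_mul (by positivity), hK₁]; ring
  have hfar : ∫⁻ ρ in Ioi R, ENNReal.ofReal (ρ ^ (δ - 4)) * ∫⁻ y in ball x ρ, g y ≤
      K₂ * (ENNReal.ofReal (R ^ (-b)) * N) := by
    calc _ ≤ ∫⁻ ρ in Ioi R, ENNReal.ofReal (ρ ^ (-b - 1)) * (V * V ^ (-(1 / p)) * N) := by
          refine setLIntegral_mono' measurableSet_Ioi fun ρ hρ => ?_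
          have hρ0 : 0 < ρ := hR.trans hρ
          have h1 : ENNReal.ofReal (ρ ^ (-b - 1)) = ENNReal.ofReal (ρ ^ (δ - 4)) *
              ENNReal.ofReal (ρ ^ 3) * ENNReal.ofReal (ρ ^ (-((3 - θ) / p))) := by
            rw [← ENNReal.ofReal_mul (by positivity), ← ENNReal.ofReal_mul (by positivity),
              ← rpow_natCast, ← rpow_add hρ0, ← rpow_add hρ0, hab]
            congr 2; push_cast; ring
          have h2 := hN.setLIntegral_ball_le hp hg x hρ0
          rw [volume_ball_E3 x hρ0.le] at h2
          exact (mul_le_mul_right h2 _).trans (le_of_eq (by rw [h1]; ring))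
      _ = ENNReal.ofReal (R ^ (-b) / b) * (V * V ^ (-(1 / p)) * N) := by
          rw [lintegral_mul_const _ (by fun_prop), setLIntegral_Ioi_rpow_neg hb hR]
      _ = _ := by
          rw [div_eq_mul_inv, ENNReal.ofReal_mul (by positivity), hK₂]; ring
  rw [← Ioc_union_Ioi_eq_Ioi hR.le]
  refine (lintegral_union_le _ _ _).trans ((add_le_add hnear hfar).trans ?_)
  rw [mul_add]
  gcongr
  · exact le_self_add
  · exact le_add_self

/-- Optimisation over the radius `R` in an estimate by `R ^ δ * A + R ^ (-b) * N`. -/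
theorem le_rpow_mul_rpow_of_forall_radius {δ b : ℝ} (hδ : 0 < δ) (hb : 0 < b)
    {I K A N : ℝ≥0∞} (hK : K ≠ ⊤) (hN : N ≠ ⊤) (hNA : N = 0 → A = 0)
    (h : ∀ R : ℝ, 0 < R → I ≤ K * (ENNReal.ofReal (R ^ δ) * A + ENNReal.ofReal (R ^ (-b)) * N)) :
    I ≤ 2 * K * (A ^ (b / (δ + b)) * N ^ (δ / (δ + b))) := by
  have hab : 0 < δ + b := by positivity
  rcases eq_or_ne A 0 with rfl | hA0
  · have hlim : Tendsto (fun R : ℝ => K * (ENNReal.ofReal (R ^ (-b)) * N)) atTop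
        (𝓝 (K * (0 * N))) := by
      refine ENNReal.Tendsto.const_mul (ENNReal.Tendsto.mul_const ?_ (Or.inr hN)) (Or.inr hK)
      simpa using ENNReal.tendsto_ofReal (tendsto_rpow_neg_atTop hb)
    have hI : I ≤ K * (0 * N) := by
      refine ge_of_tendsto hlim ?_
      filter_upwards [eventually_gt_atTop 0] with R hR
      simpa using h R hR
    refine hI.trans ?_
    simp
  have hN0 : N ≠ 0 := fun h0 => hA0 (hNA h0)
  rcases eq_or_ne A ⊤ with rfl | hAt
  · have h1 : N ^ (δ / (δ + b)) ≠ 0 := by simp [ENNReal.rpow_eq_zero_iff, hN0, hN]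
    rw [ENNReal.top_rpow_of_pos (by positivity), ENNReal.top_mul h1]
    have h2 := h 1 one_pos
    simp only [one_rpow, ENNReal.ofReal_one, one_mul, top_add] at h2
    refine h2.trans ?_
    gcongr
    exact le_mul_of_one_le_left zero_le one_le_two
  obtain ⟨α, hα, rfl⟩ : ∃ α : ℝ, 0 < α ∧ ENNReal.ofReal α = A :=
    ⟨A.toReal, ENNReal.toReal_pos hA0 hAt, ENNReal.ofReal_toReal hAt⟩
  obtain ⟨n, hn, rfl⟩ : ∃ n : ℝ, 0 < n ∧ ENNReal.ofReal n = N :=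
    ⟨N.toReal, ENNReal.toReal_pos hN0 hN, ENNReal.ofReal_toReal hN⟩
  have hR : 0 < (n / α) ^ (1 / (δ + b)) := by positivity
  have h1 : ((n / α) ^ (1 / (δ + b))) ^ δ * α = α ^ (b / (δ + b)) * n ^ (δ / (δ + b)) := by
    rw [← rpow_mul (by positivity), div_rpow hn.le hα.le, one_div_mul_eq_div,
      div_mul_eq_mul_div, div_eq_iff (by positivity), mul_right_comm, ← rpow_add hα,
      ← add_div, add_comm b, div_self hab.ne', rpow_one, mul_comm]
  have h2 : ((n / α) ^ (1 / (δ + b))) ^ (-b) * n = α ^ (b / (δ + b)) * n ^ (δ / (δ + b)) := by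
    rw [← rpow_mul (by positivity), mul_neg, rpow_neg (by positivity), div_rpow hn.le hα.le,
      one_div_mul_eq_div, inv_div, div_mul_eq_mul_div, div_eq_iff (by positivity), mul_assoc,
      ← rpow_add hn, ← add_div, div_self hab.ne', rpow_one]
  refine (h _ hR).trans (le_of_eq ?_)
  rw [← ENNReal.ofReal_mul (by positivity), ← ENNReal.ofReal_mul (by positivity), h1, h2,
    ENNReal.ofReal_rpow_of_pos hα, ENNReal.ofReal_rpow_of_pos hn,
    ← ENNReal.ofReal_mul (by positivity)]
  ring

theorem MorreyBound.maximalFn_eq_zero {p θ : ℝ} (hp : 1 < p) {g : E3 → ℝ≥0∞} (hg : Measurable g)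
    (hN : MorreyBound p θ g 0) (x : E3) : maximalFn g x = 0 := by
  refine le_zero_iff.1 (maximalFn_le_iff.2 fun c r hx => ?_)
  simpa using hN.setLIntegral_ball_le hp hg c (pos_of_mem_ball hx)

theorem morreyBound_morreyNorm {p θ : ℝ} (hp : 0 < p) (f : E3 → ℝ) :
    MorreyBound p θ (fun y => ‖f y‖ₑ) (morreyNorm p θ f) := by
  intro x r hr
  have h1 : ENNReal.ofReal (r ^ (-(θ / p))) * (∫⁻ y in ball x r, ‖f y‖ₑ ^ p) ^ (1 / p) ≤
      morreyNorm p θ f :=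
    le_iSup_of_le x (le_iSup_of_le r (le_iSup_of_le hr le_rfl))
  have h2 : ENNReal.ofReal (r ^ θ) * ENNReal.ofReal (r ^ (-(θ / p))) ^ p = 1 := by
    rw [ENNReal.ofReal_rpow_of_pos (by positivity), ← ENNReal.ofReal_mul (by positivity),
      ← rpow_mul hr.le, ← rpow_add hr, neg_mul, div_mul_cancel₀ _ hp.ne', add_neg_cancel, rpow_zero,
      ENNReal.ofReal_one]
  calc ∫⁻ y in ball x r, ‖f y‖ₑ ^ p
      = ENNReal.ofReal (r ^ θ) * ENNReal.ofReal (r ^ (-(θ / p))) ^ p *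
          ((∫⁻ y in ball x r, ‖f y‖ₑ ^ p) ^ (1 / p)) ^ p := by
        rw [h2, one_mul, ← ENNReal.rpow_mul, one_div_mul_cancel hp.ne', ENNReal.rpow_one]
    _ = ENNReal.ofReal (r ^ θ) * (ENNReal.ofReal (r ^ (-(θ / p))) *
          (∫⁻ y in ball x r, ‖f y‖ₑ ^ p) ^ (1 / p)) ^ p := by
        rw [ENNReal.mul_rpow_of_nonneg _ _ hp.le, mul_assoc]
    _ ≤ _ := by gcongr

theorem MorreyBound.morreyNorm_le {q θ : ℝ} (hq : 0 < q) {F : E3 → ℝ} {N : ℝ≥0∞}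
    (h : MorreyBound q θ (fun y => ‖F y‖ₑ) N) : morreyNorm q θ F ≤ N := by
  refine iSup_le fun x => iSup_le fun r => iSup_le fun hr => ?_
  calc ENNReal.ofReal (r ^ (-(θ / q))) * (∫⁻ y in ball x r, ‖F y‖ₑ ^ q) ^ (1 / q)
      ≤ ENNReal.ofReal (r ^ (-(θ / q))) * (ENNReal.ofReal (r ^ θ) * N ^ q) ^ (1 / q) := by
        gcongr; exact h x r hr
    _ = N := by
        rw [ENNReal.mul_rpow_of_nonneg _ _ (by positivity), ← ENNReal.rpow_mul,
          mul_one_div_cancel hq.ne', ENNReal.rpow_one, ENNReal.ofReal_rpow_of_pos (by positivity),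
          ← mul_assoc, ← ENNReal.ofReal_mul (by positivity), ← rpow_mul hr.le, ← rpow_add hr,
          mul_one_div, neg_add_cancel, rpow_zero, ENNReal.ofReal_one, one_mul]

theorem morreyNorm_congr_ae {p θ : ℝ} {f g : E3 → ℝ} (h : f =ᵐ[volume] g) :
    morreyNorm p θ f = morreyNorm p θ g := by
  unfold morreyNorm
  refine iSup_congr fun x => iSup_congr fun r => iSup_congr fun _ => ?_
  congr 2
  refine lintegral_congr_ae (ae_restrict_of_ae ?_)
  filter_upwards [h] with y hy
  rw [hy]

/-- Boundedness of the Riesz potential in terms of Morrey growth bounds. -/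
theorem exists_morreyBound_riesz {δ p q θ : ℝ} (hδ : 0 < δ) (hδ' : δ < 3)
    (hp : 1 < p) (hpq : p < q) (hθ : θ < 3) (hExp : 1 / p - 1 / q = δ / (3 - θ)) :
    ∃ C : ℝ≥0∞, C ≠ ⊤ ∧ ∀ (g : E3 → ℝ≥0∞) (N : ℝ≥0∞), N ≠ ⊤ → Measurable g →
      MorreyBound p θ g N →
      MorreyBound q θ (fun x => ∫⁻ y, ENNReal.ofReal (‖x - y‖ ^ (δ - 3)) * g y) (C * N) := by
  have hp0 : 0 < p := by linarith
  have hq0 : 0 < q := by linarith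
  have h3 : 0 < 3 - θ := by linarith
  have hb : 0 < (3 - θ) / q := by positivity
  have hab : (3 - θ) / p = δ + (3 - θ) / q := by
    rw [eq_div_iff h3.ne'] at hExp
    rw [← hExp]; ring
  have he1 : (3 - θ) / q / (δ + (3 - θ) / q) = p / q := by
    rw [← hab]; field_simp
  have he2 : δ / (δ + (3 - θ) / q) = 1 - p / q := by
    rw [← he1]; field_simp; ring
  have hpq1 : p / q < 1 := (div_lt_one hq0).2 hpq
  obtain ⟨K, hK, hpot⟩ := exists_lintegral_riesz_le_add hδ hδ' hp hb hab
  obtain ⟨C, hC, hmax⟩ := exists_morreyBound_maximalFn hp hθ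
  refine ⟨2 * K * C ^ (p / q), ?_, ?_⟩
  · have : C ^ (p / q) ≠ ⊤ := ENNReal.rpow_ne_top_of_nonneg (by positivity) hC
    finiteness
  intro g N hNt hg hN x₀ r hr
  have hpt : ∀ x, ∫⁻ y, ENNReal.ofReal (‖x - y‖ ^ (δ - 3)) * g y ≤
      2 * K * N ^ (1 - p / q) * maximalFn g x ^ (p / q) := by
    intro x
    have := le_rpow_mul_rpow_of_forall_radius hδ hb hK hNt
      (fun h0 => MorreyBound.maximalFn_eq_zero hp hg (h0 ▸ hN) x) (hpot g N hg hN x)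
    rw [he1, he2] at this
    exact this.trans (le_of_eq (by ring))
  have hNN : N ^ (1 - p / q) * N ^ (p / q) = N := by
    rw [← ENNReal.rpow_add_of_nonneg _ _ (by linarith) (by positivity), sub_add_cancel,
      ENNReal.rpow_one]
  calc _ ≤ ∫⁻ x in ball x₀ r, (2 * K * N ^ (1 - p / q)) ^ q * maximalFn g x ^ p := by
        refine lintegral_mono fun x => ?_
        calc _ ≤ (2 * K * N ^ (1 - p / q) * maximalFn g x ^ (p / q)) ^ q := by
              gcongr; exact hpt x
          _ = _ := by
              rw [ENNReal.mul_rpow_of_nonneg _ _ hq0.le, ← ENNReal.rpow_mul (maximalFn g x),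
                div_mul_cancel₀ _ hq0.ne']
    _ = (2 * K * N ^ (1 - p / q)) ^ q * ∫⁻ x in ball x₀ r, maximalFn g x ^ p :=
        lintegral_const_mul _ ((measurable_maximalFn g).pow_const p)
    _ ≤ (2 * K * N ^ (1 - p / q)) ^ q * (ENNReal.ofReal (r ^ θ) * (C * N) ^ p) := by
        gcongr; exact hmax g N hg hN x₀ r hr
    _ = ENNReal.ofReal (r ^ θ) * (2 * K * N ^ (1 - p / q) * (C * N) ^ (p / q)) ^ q := by
        rw [ENNReal.mul_rpow_of_nonneg _ ((C * N) ^ (p / q)) hq0.le, ← ENNReal.rpow_mul (C * N),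
          div_mul_cancel₀ _ hq0.ne']
        ring
    _ = ENNReal.ofReal (r ^ θ) *
          (2 * K * C ^ (p / q) * (N ^ (1 - p / q) * N ^ (p / q))) ^ q := by
        rw [ENNReal.mul_rpow_of_nonneg C _ (by positivity)]
        congr 2; ring
    _ = _ := by rw [hNN]

theorem aemeasurable_of_riesz_mul {δ : ℝ} {f : E3 → ℝ} {x : E3}
    (h : AEMeasurable (fun y => ‖x - y‖ ^ (δ - 3) * f y)) : AEMeasurable f := by
  have hk : Measurable fun y : E3 => (‖x - y‖ ^ (δ - 3))⁻¹ := by fun_prop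
  refine (hk.aemeasurable.mul h).congr ?_
  filter_upwards [Measure.ae_ne volume x] with y hy
  have : 0 < ‖x - y‖ := norm_pos_iff.2 (sub_ne_zero.2 hy.symm)
  simp only [Pi.mul_apply]
  rw [inv_mul_cancel_left₀ (by positivity)]

/-- **Riesz potential on Morrey spaces.**  Let `S(x) = |x|^{δ-3}` with `δ ∈ (0,3)`.
If `1 < p < q < ∞`, `0 ≤ θ < 3` and `1/p - 1/q = δ/(3-θ)`, then
`‖S ∗ f‖_{q,θ} ≤ C ‖f‖_{p,θ}` with `C` independent of `f`. -/
theorem riesz_potential_morrey (δ p q θ : ℝ) (hδ : 0 < δ) (hδ' : δ < 3)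
    (hp : 1 < p) (hpq : p < q) (hθ : 0 ≤ θ) (hθ' : θ < 3)
    (hExp : 1 / p - 1 / q = δ / (3 - θ)) :
    ∃ C : ℝ, 0 < C ∧ ∀ f : E3 → ℝ, morreyNorm p θ f ≠ ⊤ →
      morreyNorm q θ (fun x => ∫ y, ‖x - y‖ ^ (δ - 3) * f y) ≤
        ENNReal.ofReal C * morreyNorm p θ f := by
  have hp0 : 0 < p := by linarith
  have hq0 : 0 < q := by linarith
  obtain ⟨C, hC, hbound⟩ := exists_morreyBound_riesz hδ hδ' hp hpq hθ' hExp
  refine ⟨C.toReal + 1, by positivity, fun f hf => ?_⟩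
  by_cases hfm : AEMeasurable f
  · have hN : MorreyBound p θ (fun y => ‖hfm.mk f y‖ₑ) (morreyNorm p θ f) := by
      rw [morreyNorm_congr_ae hfm.ae_eq_mk]
      exact morreyBound_morreyNorm hp0 _
    have hCle : C ≤ ENNReal.ofReal (C.toReal + 1) := by
      rw [← ENNReal.ofReal_toReal hC]
      exact ENNReal.ofReal_le_ofReal (by simp)
    refine le_trans (MorreyBound.morreyNorm_le hq0 fun x r hr => ?_)
      (mul_le_mul_left hCle _)
    refine le_trans (lintegral_mono fun x => ?_)
      (hbound _ _ hf hfm.measurable_mk.enorm hN x r hr)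
    dsimp only
    gcongr
    refine (enorm_integral_le_lintegral_enorm _).trans (le_of_eq (lintegral_congr_ae ?_))
    filter_upwards [hfm.ae_eq_mk] with y hy
    rw [enorm_mul, Real.enorm_of_nonneg (by positivity), hy]
  · have h0 : (fun x => ∫ y, ‖x - y‖ ^ (δ - 3) * f y) = fun _ => (0 : ℝ) := by
      funext x
      exact integral_undef fun hi => hfm (aemeasurable_of_riesz_mul hi.aemeasurable)
    rw [h0]
    simp [morreyNorm, hq0]
end
end

section
/- (Time derivative of the heat semigroup between Morrey spaces.) Let 1 ≤ q₁ ≤ q₂ < ∞ and 0 ≤ λ₁ ≤ λ₂ < 3, and set α₁ = (3−λ₁)/q₁ and α₂ = (3−λ₂)/q₂. Then there exists a constant C > 0, depending only on q₁, q₂, λ₁, λ₂, such that for every t > 0 and every f ∈ M^{q₁,λ₁}(ℝ³), t^{1 + (α₁−α₂)/2} ‖∂_t G(·,t)∗f‖_{q₂,λ₂} ≤ C ‖f‖_{q₁,λ₁}, where ∂_t G(·,t) is the time derivative of the heat kernel at time t. -/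
open MeasureTheory Metric Real Set Filter
open scoped ENNReal NNReal BigOperators Topology

noncomputable section

/-- Heat kernel on ℝ³. -/
def heatKernel (t : ℝ) (x : E3) : ℝ :=
  (4 * π * t) ^ (-(3 : ℝ) / 2) * Real.exp (-‖x‖ ^ 2 / (4 * t))

/-- The exponential weight `exp (-|z| / s)` of scale `s`. -/
def expWeight (s : ℝ) (z : E3) : ℝ≥0∞ := ENNReal.ofReal (Real.exp (-(‖z‖ / s)))

lemma measurable_expWeight (s : ℝ) : Measurable (expWeight s) := by
  unfold expWeight; fun_prop

/-- Exponential weights are dominated by a rapidly decaying superposition of indicators of balls. -/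
lemma expWeight_le_tsum_indicator {s : ℝ} (hs : 0 < s) (z : E3) :
    expWeight s z ≤ ∑' k : ℕ, ENNReal.ofReal (Real.exp (-(k : ℝ))) *
      (Metric.ball (0 : E3) ((k + 1) * s)).indicator 1 z := by
  refine le_trans ?_ (ENNReal.le_tsum ⌊‖z‖ / s⌋₊)
  have hz : z ∈ Metric.ball (0 : E3) ((⌊‖z‖ / s⌋₊ + 1) * s) := by
    rw [mem_ball_zero_iff, ← div_lt_iff₀ hs]
    exact Nat.lt_floor_add_one _
  rw [indicator_of_mem hz, Pi.one_apply, mul_one]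
  refine ENNReal.ofReal_le_ofReal (Real.exp_le_exp.2 (neg_le_neg ?_))
  exact Nat.floor_le (by positivity)

lemma tsum_exp_mul_rpow_ne_top {lam : ℝ} (hlam : lam ≤ 3) :
    ∑' k : ℕ, ENNReal.ofReal (Real.exp (-(k : ℝ))) * ENNReal.ofReal (k + 1) ^ lam ≠ ⊤ := by
  have hsum : Summable fun k : ℕ => Real.exp (-(k : ℝ)) * ((k : ℝ) + 1) ^ (3 : ℕ) := by
    have h := (summable_nat_add_iff 1).2 (Real.summable_pow_mul_exp_neg_nat_mul 3 one_pos)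
    refine (h.mul_left (Real.exp 1)).congr fun k => ?_
    have : Real.exp (-(k : ℝ)) = Real.exp 1 * Real.exp (-1 * ((k + 1 : ℕ) : ℝ)) := by
      rw [← Real.exp_add]; congr 1; push_cast; ring
    rw [this]; push_cast; ring
  refine ne_top_of_le_ne_top hsum.tsum_ofReal_ne_top (ENNReal.tsum_le_tsum fun k => ?_)
  have hk : (0 : ℝ) < k + 1 := by positivity
  rw [ENNReal.ofReal_rpow_of_pos hk, ← ENNReal.ofReal_mul (Real.exp_pos _).le]
  refine ENNReal.ofReal_le_ofReal (mul_le_mul_of_nonneg_left ?_ (Real.exp_pos _).le)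
  rw [← Real.rpow_natCast]
  exact Real.rpow_le_rpow_of_exponent_le (by linarith [Nat.cast_nonneg (α := ℝ) k])
    (by exact_mod_cast hlam)

lemma exists_lintegral_expWeight_mul_le {lam : ℝ} (hlam : lam ≤ 3) :
    ∃ C : ℝ≥0∞, C ≠ ⊤ ∧ ∀ (s : ℝ) (_ : 0 < s) (g : E3 → ℝ≥0∞) (_ : Measurable g) (M : ℝ≥0∞)
      (_ : ∀ x r, 0 < r → ∫⁻ y in Metric.ball x r, g y ≤ M * ENNReal.ofReal r ^ lam) (x : E3),
      ∫⁻ y, expWeight s (x - y) * g y ≤ C * M * ENNReal.ofReal s ^ lam := by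
  refine ⟨_, tsum_exp_mul_rpow_ne_top hlam, fun s hs g hg M hM x => ?_⟩
  have hball : ∀ (r : ℝ) (y : E3),
      (Metric.ball (0 : E3) r).indicator (1 : E3 → ℝ≥0∞) (x - y) * g y
        = (Metric.ball x r).indicator g y := fun r y => by
    by_cases h : y ∈ Metric.ball x r
    · have h' : x - y ∈ Metric.ball (0 : E3) r := by
        rwa [mem_ball_zero_iff, ← dist_eq_norm, ← mem_ball']
      rw [indicator_of_mem h, indicator_of_mem h', Pi.one_apply, one_mul]
    · have h' : x - y ∉ Metric.ball (0 : E3) r := by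
        rwa [mem_ball_zero_iff, ← dist_eq_norm, ← mem_ball']
      rw [indicator_of_notMem h, indicator_of_notMem h', zero_mul]
  calc ∫⁻ y, expWeight s (x - y) * g y
      ≤ ∫⁻ y, ∑' k : ℕ, ENNReal.ofReal (Real.exp (-(k : ℝ))) *
          (Metric.ball x ((k + 1) * s)).indicator g y := by
        refine lintegral_mono fun y => ?_
        refine (mul_le_mul_left (expWeight_le_tsum_indicator hs (x - y)) (g y)).trans_eq ?_
        rw [← ENNReal.tsum_mul_right]
        exact tsum_congr fun k => by rw [mul_assoc, hball]
    _ = ∑' k : ℕ, ENNReal.ofReal (Real.exp (-(k : ℝ))) *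
          ∫⁻ y in Metric.ball x ((k + 1) * s), g y := by
        rw [lintegral_tsum fun k => by
          exact ((hg.indicator measurableSet_ball).const_mul _).aemeasurable]
        refine tsum_congr fun k => ?_
        rw [lintegral_const_mul _ (hg.indicator measurableSet_ball),
          lintegral_indicator measurableSet_ball]
    _ ≤ ∑' k : ℕ, ENNReal.ofReal (Real.exp (-(k : ℝ))) * ENNReal.ofReal (k + 1) ^ lam *
          (M * ENNReal.ofReal s ^ lam) := by
        refine ENNReal.tsum_le_tsum fun k => ?_
        have hk : (0 : ℝ) < k + 1 := by positivity
        rw [mul_assoc]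
        refine mul_le_mul_right ((hM x _ (by positivity)).trans_eq ?_) _
        rw [ENNReal.ofReal_mul hk.le, ENNReal.mul_rpow_of_ne_top ENNReal.ofReal_ne_top
          ENNReal.ofReal_ne_top]
        ring
    _ = _ := by rw [ENNReal.tsum_mul_right, mul_assoc]

/-- Jensen's inequality for a weighted integral. -/
lemma rpow_lintegral_mul_le {α : Type*} [MeasurableSpace α] {μ : Measure α} {q : ℝ} (hq : 1 ≤ q)
    {w g : α → ℝ≥0∞} (hw : Measurable w) (hg : Measurable g) :
    (∫⁻ y, w y * g y ∂μ) ^ q ≤ (∫⁻ y, w y ∂μ) ^ (q - 1) * ∫⁻ y, w y * g y ^ q ∂μ := by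
  have hq0 : 0 < q := by linarith
  have h := eLpNorm'_le_eLpNorm'_mul_rpow_measure_univ (μ := μ.withDensity w) one_pos hq
    hg.aestronglyMeasurable
  simp only [eLpNorm', enorm_eq_self, ENNReal.rpow_one, div_one,
    withDensity_apply _ MeasurableSet.univ, Measure.restrict_univ] at h
  rw [lintegral_withDensity_eq_lintegral_mul _ hw hg,
    lintegral_withDensity_eq_lintegral_mul _ hw (hg.pow_const q)] at h
  refine (ENNReal.rpow_le_rpow h hq0.le).trans_eq ?_
  rw [ENNReal.mul_rpow_of_nonneg _ _ hq0.le, ← ENNReal.rpow_mul, ← ENNReal.rpow_mul, mul_comm,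
    one_div_mul_cancel hq0.ne', ENNReal.rpow_one, sub_mul, one_div_mul_cancel hq0.ne', one_mul]
  rfl

lemma volume_ball_eq_rpow (x : E3) {r : ℝ} (hr : 0 < r) :
    volume (Metric.ball x r) = volume (Metric.ball (0 : E3) 1) * ENNReal.ofReal r ^ (3 : ℝ) := by
  rw [Measure.addHaar_ball _ x hr.le, finrank_euclideanSpace_fin, mul_comm,
    ENNReal.ofReal_rpow_of_pos hr]
  norm_cast

lemma exists_lintegral_expWeight_le :
    ∃ A : ℝ≥0∞, A ≠ ⊤ ∧ ∀ (s : ℝ) (_ : 0 < s) (x : E3),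
      ∫⁻ y, expWeight s (x - y) ≤ A * ENNReal.ofReal s ^ (3 : ℝ) := by
  obtain ⟨C, hC, h⟩ := exists_lintegral_expWeight_mul_le (le_refl (3 : ℝ))
  refine ⟨C * volume (Metric.ball (0 : E3) 1), ENNReal.mul_ne_top hC measure_ball_lt_top.ne,
    fun s hs x => ?_⟩
  simpa using h s hs 1 measurable_one (volume (Metric.ball (0 : E3) 1))
    (fun x r hr => by simp [volume_ball_eq_rpow x hr]) x

/-- Convolution with the exponential weight of scale `s`. -/
def expConv (s : ℝ) (g : E3 → ℝ≥0∞) (x : E3) : ℝ≥0∞ := ∫⁻ y, expWeight s (x - y) * g y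

lemma lintegral_ball_expConv_le {lam : ℝ} {s r : ℝ} (hr : 0 < r) {g : E3 → ℝ≥0∞}
    (hg : Measurable g) {M : ℝ≥0∞}
    (hM : ∀ x r, 0 < r → ∫⁻ y in Metric.ball x r, g y ≤ M * ENNReal.ofReal r ^ lam) (x₀ : E3) :
    ∫⁻ x in Metric.ball x₀ r, expConv s g x ≤
      (∫⁻ y, expWeight s (0 - y)) * (M * ENNReal.ofReal r ^ lam) := by
  have hw := measurable_expWeight s
  have htranslate : ∀ z : E3, ∫⁻ x in Metric.ball x₀ r, g (x - z)
      = ∫⁻ x in Metric.ball (x₀ - z) r, g x := fun z => by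
    rw [← lintegral_indicator measurableSet_ball, ← lintegral_indicator measurableSet_ball,
      ← lintegral_sub_right_eq_self ((Metric.ball (x₀ - z) r).indicator g) z]
    refine lintegral_congr fun x => ?_
    have hmem : x ∈ Metric.ball x₀ r ↔ x - z ∈ Metric.ball (x₀ - z) r := by
      simp [Metric.mem_ball]
    by_cases h : x ∈ Metric.ball x₀ r
    · rw [indicator_of_mem h, indicator_of_mem (hmem.1 h)]
    · rw [indicator_of_notMem h, indicator_of_notMem (mt hmem.2 h)]
  calc ∫⁻ x in Metric.ball x₀ r, expConv s g x
      = ∫⁻ x in Metric.ball x₀ r, ∫⁻ z, expWeight s z * g (x - z) := by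
        refine lintegral_congr fun x => ?_
        rw [expConv, ← lintegral_sub_left_eq_self _ x]
        simp
    _ = ∫⁻ z, ∫⁻ x in Metric.ball x₀ r, expWeight s z * g (x - z) := by
        refine lintegral_lintegral_swap (Measurable.aemeasurable ?_)
        exact (hw.comp measurable_snd).mul (hg.comp (measurable_fst.sub measurable_snd))
    _ ≤ ∫⁻ z, expWeight s z * (M * ENNReal.ofReal r ^ lam) := by
        refine lintegral_mono fun z => ?_
        rw [lintegral_const_mul _ (by fun_prop), htranslate]
        exact mul_le_mul_right (hM _ _ hr) _
    _ = _ := by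
        rw [lintegral_mul_const _ hw, lintegral_sub_left_eq_self]

lemma exists_expConv_bounds {q lam : ℝ} (hq : 1 ≤ q) (hlam : lam ≤ 3) :
    ∃ D : ℝ≥0∞, D ≠ ⊤ ∧ ∀ (s : ℝ) (_ : 0 < s) (g : E3 → ℝ≥0∞) (_ : Measurable g) (M : ℝ≥0∞)
      (_ : ∀ x r, 0 < r → ∫⁻ y in Metric.ball x r, g y ^ q ≤ M * ENNReal.ofReal r ^ lam),
      (∀ x, expConv s g x ^ q ≤ D * M * ENNReal.ofReal s ^ (3 * (q - 1) + lam)) ∧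
      ∀ x r, 0 < r → ∫⁻ y in Metric.ball x r, expConv s g y ^ q ≤
        D * M * ENNReal.ofReal s ^ (3 * q) * ENNReal.ofReal r ^ lam := by
  obtain ⟨A, hA, hAw⟩ := exists_lintegral_expWeight_le
  obtain ⟨C, hC, hCw⟩ := exists_lintegral_expWeight_mul_le hlam
  have hq1 : 0 ≤ q - 1 := by linarith
  refine ⟨A ^ (q - 1) * (C + A), ENNReal.mul_ne_top (ENNReal.rpow_ne_top_of_nonneg hq1 hA)
    (ENNReal.add_ne_top.2 ⟨hC, hA⟩), fun s hs g hg M hM => ?_⟩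
  have hs0 : ENNReal.ofReal s ≠ 0 := by simpa using hs
  have hst : ENNReal.ofReal s ≠ ⊤ := ENNReal.ofReal_ne_top
  have hgq : Measurable fun y => g y ^ q := hg.pow_const q
  have hJ : ∀ x, expConv s g x ^ q ≤
      A ^ (q - 1) * ENNReal.ofReal s ^ (3 * (q - 1)) * expConv s (fun y => g y ^ q) x := fun x => by
    refine (rpow_lintegral_mul_le hq
      ((measurable_expWeight s).comp (measurable_const.sub measurable_id)) hg).trans ?_
    refine mul_le_mul_left ?_ _
    refine (ENNReal.rpow_le_rpow (hAw s hs x) hq1).trans_eq ?_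
    rw [ENNReal.mul_rpow_of_nonneg _ _ hq1, ← ENNReal.rpow_mul]
  refine ⟨fun x => ?_, fun x r hr => ?_⟩
  · calc expConv s g x ^ q
        ≤ A ^ (q - 1) * ENNReal.ofReal s ^ (3 * (q - 1)) * (C * M * ENNReal.ofReal s ^ lam) :=
          (hJ x).trans (mul_le_mul_right (hCw s hs _ hgq M hM x) _)
      _ = A ^ (q - 1) * C * M * ENNReal.ofReal s ^ (3 * (q - 1) + lam) := by
          rw [ENNReal.rpow_add _ _ hs0 hst]; ring
      _ ≤ _ := by gcongr; exact le_self_add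
  · have hK : A ^ (q - 1) * ENNReal.ofReal s ^ (3 * (q - 1)) ≠ ⊤ :=
      ENNReal.mul_ne_top (ENNReal.rpow_ne_top_of_nonneg hq1 hA)
        (ENNReal.rpow_ne_top_of_nonneg (by linarith) hst)
    calc ∫⁻ y in Metric.ball x r, expConv s g y ^ q
        ≤ A ^ (q - 1) * ENNReal.ofReal s ^ (3 * (q - 1)) *
            ∫⁻ y in Metric.ball x r, expConv s (fun y => g y ^ q) y := by
          rw [← lintegral_const_mul' _ _ hK]
          exact lintegral_mono hJ
      _ ≤ A ^ (q - 1) * ENNReal.ofReal s ^ (3 * (q - 1)) *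
            (A * ENNReal.ofReal s ^ (3 : ℝ) * (M * ENNReal.ofReal r ^ lam)) := by
          refine mul_le_mul_right ((lintegral_ball_expConv_le hr hgq hM x).trans ?_) _
          exact mul_le_mul_left (hAw s hs 0) _
      _ = A ^ (q - 1) * A * M * ENNReal.ofReal s ^ (3 * q) * ENNReal.ofReal r ^ lam := by
          rw [show 3 * q = 3 * (q - 1) + 3 by ring, ENNReal.rpow_add _ _ hs0 hst]; ring
      _ ≤ _ := by gcongr; exact le_add_self

lemma rpow_mul_rpow_le_of_le {a b u v w : ℝ} (ha : 0 < a) (hab : a ≤ b) (huv : u ≤ v) :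
    ENNReal.ofReal a ^ (w - u) * ENNReal.ofReal b ^ u ≤
      ENNReal.ofReal a ^ (w - v) * ENNReal.ofReal b ^ v := by
  have hb : 0 < b := ha.trans_le hab
  have ha0 : ENNReal.ofReal a ≠ 0 := by simpa using ha
  have hb0 : ENNReal.ofReal b ≠ 0 := by simpa using hb
  have hat : ENNReal.ofReal a ≠ ⊤ := ENNReal.ofReal_ne_top
  have hbt : ENNReal.ofReal b ≠ ⊤ := ENNReal.ofReal_ne_top
  rw [show w - u = (w - v) + (v - u) by ring, ENNReal.rpow_add _ _ ha0 hat, mul_assoc]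
  refine mul_le_mul_right ?_ _
  calc ENNReal.ofReal a ^ (v - u) * ENNReal.ofReal b ^ u
      ≤ ENNReal.ofReal b ^ (v - u) * ENNReal.ofReal b ^ u := by gcongr
    _ = ENNReal.ofReal b ^ v := by rw [← ENNReal.rpow_add _ _ hb0 hbt, sub_add_cancel]

/-- Interpolation between a uniform bound and a Morrey bound above the scale `s`. -/
lemma lintegral_ball_rpow_le_of_le {q₁ q₂ lam₁ lam₂ s r : ℝ} (hq₁ : 1 ≤ q₁) (hq : q₁ ≤ q₂)
    (hlam : lam₁ ≤ lam₂) (hlam₂ : lam₂ ≤ 3) (hs : 0 < s) (hr : 0 < r) {F : E3 → ℝ≥0∞}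
    {S : ℝ≥0∞} (hS : S ≠ ⊤) (hF : ∀ x, F x ≤ S) (x : E3)
    (hB : ∫⁻ y in Metric.ball x r, F y ^ q₁ ≤
      S ^ q₁ * (ENNReal.ofReal s ^ (3 - lam₁) * ENNReal.ofReal r ^ lam₁)) :
    ∫⁻ y in Metric.ball x r, F y ^ q₂ ≤ (1 + volume (Metric.ball (0 : E3) 1)) * S ^ q₂ *
      (ENNReal.ofReal s ^ (3 - lam₂) * ENNReal.ofReal r ^ lam₂) := by
  rcases le_total s r with h | h
  · have hd : 0 ≤ q₂ - q₁ := by linarith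
    have hq0 : 0 ≤ q₁ := by linarith
    have hsplit : ∀ a : ℝ≥0∞, a ^ q₂ = a ^ (q₂ - q₁) * a ^ q₁ := fun a => by
      rw [← ENNReal.rpow_add_of_nonneg _ _ hd hq0, sub_add_cancel]
    calc ∫⁻ y in Metric.ball x r, F y ^ q₂
        ≤ ∫⁻ y in Metric.ball x r, S ^ (q₂ - q₁) * F y ^ q₁ :=
          lintegral_mono fun y => (hsplit (F y)).trans_le
            (mul_le_mul_left (ENNReal.rpow_le_rpow (hF y) hd) _)
      _ = S ^ (q₂ - q₁) * ∫⁻ y in Metric.ball x r, F y ^ q₁ :=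
          lintegral_const_mul' _ _ (ENNReal.rpow_ne_top_of_nonneg hd hS)
      _ ≤ S ^ (q₂ - q₁) * (S ^ q₁ * (ENNReal.ofReal s ^ (3 - lam₁) * ENNReal.ofReal r ^ lam₁)) :=
          mul_le_mul_right hB _
      _ = 1 * S ^ q₂ * (ENNReal.ofReal s ^ (3 - lam₁) * ENNReal.ofReal r ^ lam₁) := by
          rw [hsplit S]; ring
      _ ≤ _ := mul_le_mul' (mul_le_mul_left le_self_add _) (rpow_mul_rpow_le_of_le hs h hlam)
  · calc ∫⁻ y in Metric.ball x r, F y ^ q₂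
        ≤ ∫⁻ _ in Metric.ball x r, S ^ q₂ :=
          lintegral_mono fun y => ENNReal.rpow_le_rpow (hF y) (by linarith)
      _ = volume (Metric.ball (0 : E3) 1) * S ^ q₂ * ENNReal.ofReal r ^ (3 : ℝ) := by
          rw [setLIntegral_const, volume_ball_eq_rpow x hr]; ring
      _ ≤ _ := by
          refine mul_le_mul' (mul_le_mul_left le_add_self _) ?_
          have := rpow_mul_rpow_le_of_le (w := 3) hr h (sub_nonneg.2 hlam₂)
          rwa [sub_zero, ENNReal.rpow_zero, mul_one, sub_sub_cancel, mul_comm] at this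

lemma morrey_term_le_iff {p lam r : ℝ} (hp : 0 < p) (hr : 0 < r) (I N : ℝ≥0∞) :
    ENNReal.ofReal (r ^ (-(lam / p))) * I ^ (1 / p) ≤ N ↔
      I ≤ N ^ p * ENNReal.ofReal r ^ lam := by
  have hr0 : ENNReal.ofReal r ≠ 0 := by simpa using hr
  have hrt : ENNReal.ofReal r ≠ ⊤ := ENNReal.ofReal_ne_top
  have hl0 : ENNReal.ofReal r ^ lam ≠ 0 := (ENNReal.rpow_pos (pos_iff_ne_zero.2 hr0) hrt).ne'
  have hlt : ENNReal.ofReal r ^ lam ≠ ⊤ := ENNReal.rpow_ne_top_of_ne_zero hr0 hrt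
  have h : ENNReal.ofReal (r ^ (-(lam / p))) = ((ENNReal.ofReal r ^ lam)⁻¹) ^ (1 / p) := by
    rw [← ENNReal.ofReal_rpow_of_pos hr, ← ENNReal.rpow_neg, ← ENNReal.rpow_mul]
    congr 1; ring
  rw [h, ← ENNReal.mul_rpow_of_nonneg _ _ (by positivity), one_div, ENNReal.rpow_inv_le_iff hp,
    ENNReal.inv_mul_le_iff hl0 hlt, mul_comm]

lemma exists_expConv_morrey_bound {q₁ q₂ lam₁ lam₂ : ℝ} (hq₁ : 1 ≤ q₁) (hq : q₁ ≤ q₂)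
    (hlam : lam₁ ≤ lam₂) (hlam₂ : lam₂ ≤ 3) :
    ∃ K : ℝ≥0∞, K ≠ ⊤ ∧ ∀ (s : ℝ) (_ : 0 < s) (g : E3 → ℝ≥0∞) (_ : Measurable g) (N : ℝ≥0∞)
      (_ : N ≠ ⊤)
      (_ : ∀ x r, 0 < r → ∫⁻ y in Metric.ball x r, g y ^ q₁ ≤ N ^ q₁ * ENNReal.ofReal r ^ lam₁)
      (x : E3) (r : ℝ) (_ : 0 < r),
      ∫⁻ y in Metric.ball x r, expConv s g y ^ q₂ ≤
        (K * N * ENNReal.ofReal s ^ (3 - (3 - lam₁) / q₁ + (3 - lam₂) / q₂)) ^ q₂ *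
          ENNReal.ofReal r ^ lam₂ := by
  obtain ⟨D, hD, h⟩ := exists_expConv_bounds hq₁ (hlam.trans hlam₂)
  have hq₁0 : 0 < q₁ := by linarith
  have hq₂0 : 0 < q₂ := by linarith
  have hv : (1 + volume (Metric.ball (0 : E3) 1)) ≠ ⊤ :=
    ENNReal.add_ne_top.2 ⟨ENNReal.one_ne_top, measure_ball_lt_top.ne⟩
  refine ⟨(1 + volume (Metric.ball (0 : E3) 1)) ^ (1 / q₂) * D ^ (1 / q₁),
    ENNReal.mul_ne_top (ENNReal.rpow_ne_top_of_nonneg (by positivity) hv)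
      (ENNReal.rpow_ne_top_of_nonneg (by positivity) hD),
    fun s hs g hg N hN hM x r hr => ?_⟩
  obtain ⟨hsup, hloc⟩ := h s hs g hg _ hM
  have hs0 : ENNReal.ofReal s ≠ 0 := by simpa using hs
  have hst : ENNReal.ofReal s ≠ ⊤ := ENNReal.ofReal_ne_top
  set S : ℝ≥0∞ := D ^ (1 / q₁) * N * ENNReal.ofReal s ^ (3 - (3 - lam₁) / q₁) with hSdef
  have hS : S ≠ ⊤ :=
    ENNReal.mul_ne_top (ENNReal.mul_ne_top (ENNReal.rpow_ne_top_of_nonneg (by positivity) hD) hN)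
      (ENNReal.rpow_ne_top_of_ne_zero hs0 hst)
  have hSq : S ^ q₁ = D * N ^ q₁ * ENNReal.ofReal s ^ (3 * (q₁ - 1) + lam₁) := by
    rw [hSdef, ENNReal.mul_rpow_of_nonneg _ _ hq₁0.le, ENNReal.mul_rpow_of_nonneg _ _ hq₁0.le,
      ← ENNReal.rpow_mul, ← ENNReal.rpow_mul, one_div_mul_cancel hq₁0.ne', ENNReal.rpow_one]
    congr 2; field_simp; ring
  have key := lintegral_ball_rpow_le_of_le hq₁ hq hlam hlam₂ hs hr hS
    (fun y => (ENNReal.rpow_le_rpow_iff hq₁0).1 ((hsup y).trans_eq hSq.symm)) x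
    ((hloc x r hr).trans_eq (by
      rw [hSq, show 3 * q₁ = 3 * (q₁ - 1) + lam₁ + (3 - lam₁) by ring,
        ENNReal.rpow_add _ _ hs0 hst]
      ring))
  refine key.trans_eq ?_
  have hfactor : (1 + volume (Metric.ball (0 : E3) 1)) ^ (1 / q₂) * D ^ (1 / q₁) * N *
        ENNReal.ofReal s ^ (3 - (3 - lam₁) / q₁ + (3 - lam₂) / q₂) =
      (1 + volume (Metric.ball (0 : E3) 1)) ^ (1 / q₂) * S *
        ENNReal.ofReal s ^ ((3 - lam₂) / q₂) := by
    rw [hSdef, ENNReal.rpow_add _ _ hs0 hst]; ring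
  clear_value S
  rw [hfactor, ENNReal.mul_rpow_of_nonneg _ _ hq₂0.le, ENNReal.mul_rpow_of_nonneg _ _ hq₂0.le,
    ← ENNReal.rpow_mul, ← ENNReal.rpow_mul, one_div_mul_cancel hq₂0.ne', ENNReal.rpow_one,
    div_mul_cancel₀ _ hq₂0.ne', mul_assoc]
  ring

lemma hasDerivAt_heatKernel {t : ℝ} (ht : 0 < t) (z : E3) :
    HasDerivAt (fun τ => heatKernel τ z)
      ((4 * π * t) ^ (-(3 : ℝ) / 2) * Real.exp (-‖z‖ ^ 2 / (4 * t)) *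
        ((‖z‖ ^ 2 / (4 * t) - 3 / 2) / t)) t := by
  have h4 : 0 < 4 * π * t := by positivity
  have h1 : HasDerivAt (fun τ : ℝ => (4 * π * τ) ^ (-(3 : ℝ) / 2)) _ t :=
    ((hasDerivAt_id t).const_mul (4 * π)).rpow_const (Or.inl h4.ne')
  have h2 : HasDerivAt (fun τ : ℝ => Real.exp (-‖z‖ ^ 2 / (4 * τ))) _ t :=
    ((hasDerivAt_const t (-‖z‖ ^ 2)).div ((hasDerivAt_id t).const_mul 4)
      (by simpa using ht.ne')).exp
  refine (h1.mul h2).congr_deriv ?_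
  simp only [id, Pi.div_apply]
  rw [Real.rpow_sub_one h4.ne']
  field_simp
  ring

lemma exp_neg_sq_mul_abs_le {u : ℝ} :
    Real.exp (-(u ^ 2 / 4)) * |u ^ 2 / 4 - 3 / 2| ≤ 2 * Real.exp 2 * Real.exp (-u) := by
  have h1 : |u ^ 2 / 4 - 3 / 2| ≤ 2 * Real.exp (u ^ 2 / 8) := by
    have := Real.add_one_le_exp (u ^ 2 / 8)
    rw [abs_le]; constructor <;> nlinarith [sq_nonneg u]
  calc Real.exp (-(u ^ 2 / 4)) * |u ^ 2 / 4 - 3 / 2|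
      ≤ Real.exp (-(u ^ 2 / 4)) * (2 * Real.exp (u ^ 2 / 8)) := by gcongr
    _ = 2 * Real.exp (-(u ^ 2 / 8)) := by
        rw [mul_left_comm, ← Real.exp_add]; congr 2; ring
    _ ≤ 2 * Real.exp (2 + -u) := by
        gcongr; nlinarith [sq_nonneg (u - 4)]
    _ = _ := by rw [Real.exp_add, mul_assoc]

lemma enorm_deriv_heatKernel_le {s : ℝ} (hs : 0 < s) (z : E3) :
    ‖deriv (fun τ => heatKernel τ z) (s ^ 2)‖ₑ ≤
      ENNReal.ofReal (2 * Real.exp 2) * ENNReal.ofReal s ^ (-5 : ℝ) * expWeight s z := by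
  have ht : 0 < s ^ 2 := by positivity
  rw [(hasDerivAt_heatKernel ht z).deriv, Real.enorm_eq_ofReal_abs, expWeight,
    ENNReal.ofReal_rpow_of_pos hs, ← ENNReal.ofReal_mul (by positivity),
    ← ENNReal.ofReal_mul (by positivity)]
  refine ENNReal.ofReal_le_ofReal ?_
  have hpow : (4 * π * s ^ 2) ^ (-(3 : ℝ) / 2) ≤ s ^ (-3 : ℝ) := by
    have h : (s ^ 2) ^ (-(3 : ℝ) / 2) = s ^ (-3 : ℝ) := by
      rw [← Real.rpow_natCast, ← Real.rpow_mul hs.le]; norm_num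
    rw [← h]
    refine Real.rpow_le_rpow_of_nonpos ht ?_ (by norm_num)
    nlinarith [Real.pi_gt_three]
  have h5 : s ^ (-5 : ℝ) = s ^ (-3 : ℝ) / s ^ 2 := by
    rw [← Real.rpow_natCast, ← Real.rpow_sub hs]; norm_num
  have hu : ‖z‖ ^ 2 / (4 * s ^ 2) = (‖z‖ / s) ^ 2 / 4 := by field_simp
  have hpos : 0 < (4 * π * s ^ 2) ^ (-(3 : ℝ) / 2) := by positivity
  rw [neg_div (4 * s ^ 2), hu, abs_mul, abs_mul, abs_of_pos hpos,
    Real.abs_exp, abs_div, abs_of_pos ht, h5]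
  calc (4 * π * s ^ 2) ^ (-(3 : ℝ) / 2) * Real.exp (-((‖z‖ / s) ^ 2 / 4)) *
        (|(‖z‖ / s) ^ 2 / 4 - 3 / 2| / s ^ 2)
      = (4 * π * s ^ 2) ^ (-(3 : ℝ) / 2) / s ^ 2 *
        (Real.exp (-((‖z‖ / s) ^ 2 / 4)) * |(‖z‖ / s) ^ 2 / 4 - 3 / 2|) := by ring
    _ ≤ s ^ (-3 : ℝ) / s ^ 2 * (2 * Real.exp 2 * Real.exp (-(‖z‖ / s))) := by
        gcongr ?_ / _ * ?_
        exact exp_neg_sq_mul_abs_le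
    _ = _ := by ring

lemma ae_deriv_heatKernel_ne_zero {t : ℝ} (ht : 0 < t) (x : E3) :
    ∀ᵐ y, deriv (fun τ => heatKernel τ (x - y)) t ≠ 0 := by
  have h : ∀ᵐ y : E3, y ∉ Metric.sphere x (√(6 * t)) :=
    measure_eq_zero_iff_ae_notMem.1 (Measure.addHaar_sphere _ _ _)
  filter_upwards [h] with y hy
  rw [(hasDerivAt_heatKernel ht _).deriv]
  have h4 : 0 < 4 * π * t := by positivity
  refine mul_ne_zero (by positivity) (div_ne_zero (fun h0 => hy ?_) ht.ne')
  rw [mem_sphere', dist_eq_norm, eq_comm,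
    Real.sqrt_eq_iff_mul_self_eq (by positivity) (by positivity)]
  field_simp at h0
  linarith

lemma measurable_deriv_heatKernel {t : ℝ} (ht : 0 < t) (x : E3) :
    Measurable fun y => deriv (fun τ => heatKernel τ (x - y)) t := by
  simp_rw [fun y => (hasDerivAt_heatKernel ht (x - y)).deriv]
  fun_prop

lemma integral_deriv_heatKernel_mul_eq_zero {t : ℝ} (ht : 0 < t) {f : E3 → ℝ}
    (hf : ¬ AEMeasurable f) (x : E3) :
    ∫ y, deriv (fun τ => heatKernel τ (x - y)) t * f y = 0 := by
  refine integral_undef fun hint => hf ?_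
  refine ((hint.aestronglyMeasurable.aemeasurable).div
    (measurable_deriv_heatKernel ht x).aemeasurable).congr ?_
  filter_upwards [ae_deriv_heatKernel_ne_zero ht x] with y hy
  simp [mul_div_cancel_left₀ _ hy]

/-- **Time derivative of the heat semigroup between Morrey spaces.**  For
`1 ≤ q₁ ≤ q₂ < ∞`, `0 ≤ λ₁ ≤ λ₂ < 3`, `αᵢ = (3-λᵢ)/qᵢ`, one has
`t^{1 + (α₁-α₂)/2} ‖∂ₜG(·,t) ∗ f‖_{q₂,λ₂} ≤ C ‖f‖_{q₁,λ₁}` for all `t > 0`. -/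
theorem time_deriv_heat_conv_morrey (q₁ q₂ lam₁ lam₂ : ℝ)
    (hq₁ : 1 ≤ q₁) (hq : q₁ ≤ q₂) (hlam₁ : 0 ≤ lam₁) (hlam : lam₁ ≤ lam₂)
    (hlam₂ : lam₂ < 3) :
    ∃ C : ℝ, 0 < C ∧ ∀ t : ℝ, 0 < t → ∀ f : E3 → ℝ,
      ENNReal.ofReal (t ^ (1 + ((3 - lam₁) / q₁ - (3 - lam₂) / q₂) / 2)) *
          morreyNorm q₂ lam₂
            (fun x => ∫ y, (deriv (fun τ => heatKernel τ (x - y)) t) * f y) ≤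
        ENNReal.ofReal C * morreyNorm q₁ lam₁ f := by
  obtain ⟨K, hK, hbound⟩ := exists_expConv_morrey_bound hq₁ hq hlam hlam₂.le
  have hq₁0 : 0 < q₁ := by linarith
  have hq₂0 : 0 < q₂ := by linarith
  have hc : ENNReal.ofReal (2 * Real.exp 2) * K ≠ ⊤ := ENNReal.mul_ne_top ENNReal.ofReal_ne_top hK
  refine ⟨(ENNReal.ofReal (2 * Real.exp 2) * K).toReal + 1, by positivity, fun t ht f => ?_⟩
  by_cases hf : AEMeasurable f
  swap
  · simp [morreyNorm, integral_deriv_heatKernel_mul_eq_zero ht hf, hq₂0]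
  by_cases hN : morreyNorm q₁ lam₁ f = ⊤
  · rw [hN, ENNReal.mul_top]
    · exact le_top
    · simpa using by positivity
  set N := morreyNorm q₁ lam₁ f with hNdef
  obtain ⟨s, hs, rfl⟩ : ∃ s : ℝ, 0 < s ∧ s ^ 2 = t :=
    ⟨√t, Real.sqrt_pos.2 ht, Real.sq_sqrt ht.le⟩
  have hs0 : ENNReal.ofReal s ≠ 0 := by simpa using hs
  have hst : ENNReal.ofReal s ≠ ⊤ := ENNReal.ofReal_ne_top
  obtain ⟨g, hg, hfg⟩ := hf.enorm
  have hM : ∀ x r, 0 < r →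
      ∫⁻ y in Metric.ball x r, g y ^ q₁ ≤ N ^ q₁ * ENNReal.ofReal r ^ lam₁ := fun x r hr => by
    rw [← morrey_term_le_iff hq₁0 hr, hNdef, morreyNorm]
    refine le_trans (le_of_eq ?_) (le_iSup₂_of_le x r (le_iSup_of_le hr le_rfl))
    congr 2
    refine lintegral_congr_ae (ae_restrict_of_ae ?_)
    filter_upwards [hfg] with y hy
    rw [← hy]; rfl
  set c := ENNReal.ofReal (2 * Real.exp 2) * ENNReal.ofReal s ^ (-5 : ℝ) with hcdef
  have hct : c ≠ ⊤ :=
    ENNReal.mul_ne_top ENNReal.ofReal_ne_top (ENNReal.rpow_ne_top_of_ne_zero hs0 hst)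
  have hpt : ∀ x, ‖∫ y, deriv (fun τ => heatKernel τ (x - y)) (s ^ 2) * f y‖ₑ ≤
      c * expConv s g x := fun x => by
    refine (enorm_integral_le_lintegral_enorm _).trans ?_
    rw [expConv, ← lintegral_const_mul' _ _ hct]
    refine lintegral_mono_ae ?_
    filter_upwards [hfg] with y hy
    rw [enorm_mul, hy, ← mul_assoc]
    exact mul_le_mul_left (enorm_deriv_heatKernel_le hs _) _
  have hmorrey : morreyNorm q₂ lam₂
      (fun x => ∫ y, (deriv (fun τ => heatKernel τ (x - y)) (s ^ 2)) * f y) ≤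
      c * (K * N * ENNReal.ofReal s ^ (3 - (3 - lam₁) / q₁ + (3 - lam₂) / q₂)) := by
    refine iSup₂_le fun x r => iSup_le fun hr => ?_
    rw [morrey_term_le_iff hq₂0 hr, ENNReal.mul_rpow_of_nonneg _ _ hq₂0.le, mul_assoc]
    refine le_trans ?_ (mul_le_mul_right (hbound s hs g hg N hN hM x r hr) _)
    rw [← lintegral_const_mul' _ _ (ENNReal.rpow_ne_top_of_nonneg hq₂0.le hct)]
    refine lintegral_mono fun y => ?_
    rw [← ENNReal.mul_rpow_of_nonneg _ _ hq₂0.le]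
    exact ENNReal.rpow_le_rpow (hpt y) hq₂0.le
  have hpow : ENNReal.ofReal ((s ^ 2) ^ (1 + ((3 - lam₁) / q₁ - (3 - lam₂) / q₂) / 2)) =
      ENNReal.ofReal s ^ (2 + ((3 - lam₁) / q₁ - (3 - lam₂) / q₂)) := by
    rw [ENNReal.ofReal_rpow_of_pos hs, ← Real.rpow_natCast, ← Real.rpow_mul hs.le]
    congr 2; push_cast; ring
  have hcancel : ENNReal.ofReal s ^ (2 + ((3 - lam₁) / q₁ - (3 - lam₂) / q₂)) *
      (ENNReal.ofReal s ^ (-5 : ℝ) *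
        ENNReal.ofReal s ^ (3 - (3 - lam₁) / q₁ + (3 - lam₂) / q₂)) = 1 := by
    rw [← ENNReal.rpow_add _ _ hs0 hst, ← ENNReal.rpow_add _ _ hs0 hst]
    ring_nf
    exact ENNReal.rpow_zero
  calc _ ≤ ENNReal.ofReal s ^ (2 + ((3 - lam₁) / q₁ - (3 - lam₂) / q₂)) *
        (c * (K * N * ENNReal.ofReal s ^ (3 - (3 - lam₁) / q₁ + (3 - lam₂) / q₂))) := by
        rw [hpow]; exact mul_le_mul_right hmorrey _
    _ = ENNReal.ofReal (2 * Real.exp 2) * K * N *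
        (ENNReal.ofReal s ^ (2 + ((3 - lam₁) / q₁ - (3 - lam₂) / q₂)) *
          (ENNReal.ofReal s ^ (-5 : ℝ) *
            ENNReal.ofReal s ^ (3 - (3 - lam₁) / q₁ + (3 - lam₂) / q₂))) := by
        rw [hcdef]; ring
    _ = ENNReal.ofReal (2 * Real.exp 2) * K * N := by rw [hcancel, mul_one]
    _ ≤ _ := by
        refine mul_le_mul_left ?_ _
        rw [ENNReal.le_ofReal_iff_toReal_le hc (by positivity)]
        linarith
end
end
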